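/- arXiv:2411.15401 — 12 statements merged into one kernel-verified Lean document; each statement's English description precedes it below -/
import Mathlib

section
/- Let a < b be real numbers and n ≥ 1 an integer. For all random variables X, Y taking values in [a,b], if X dominates Y in nth-order stochastic dominance on [a,b] (X ≥ₙ^{[a,b]} Y), then X dominates Y in nth-order stochastic dominance on ℝ (X ≥ₙ Y). -/
open MeasureTheory Filter Set

/-- `E[(η−x)₊^{n−1}]`-integrand: for `n = 1` the indicator of `x ≤ η`,
for `n ≥ 2` the positive part `(η−x)₊` raised to `n−1`. -/
noncomputable def momFn (n : ℕ) (η x : ℝ) : ℝ :=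
  if n = 1 then (if x ≤ η then (1 : ℝ) else 0) else (max (η - x) 0) ^ (n - 1)

/-- `n`th-order stochastic dominance on ℝ: `X ≥ₙ Y`. -/
def SD {Ω : Type*} [MeasurableSpace Ω] (μ : Measure Ω) (X Y : Ω → ℝ) (n : ℕ) : Prop :=
  ∀ η : ℝ, (∫ ω, momFn n η (X ω) ∂μ) ≤ ∫ ω, momFn n η (Y ω) ∂μ

/-- `n`th-order stochastic dominance on `[a, r]`: `X ≥ₙ^{[a,r]} Y`. -/
def SDI {Ω : Type*} [MeasurableSpace Ω] (μ : Measure Ω) (X Y : Ω → ℝ)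
    (n : ℕ) (a r : ℝ) : Prop :=
  (∀ η ∈ Set.Icc a r, (∫ ω, momFn n η (X ω) ∂μ) ≤ ∫ ω, momFn n η (Y ω) ∂μ) ∧
  ∀ k ∈ Finset.Icc 1 n, (∫ ω, (r - X ω) ^ (k - 1) ∂μ) ≤ ∫ ω, (r - Y ω) ^ (k - 1) ∂μ

/-- To the left of `x`, the integrand `momFn n · x` vanishes. -/
lemma momFn_of_lt {n : ℕ} (hn : 1 ≤ n) {η x : ℝ} (hx : η < x) : momFn n η x = 0 := by
  unfold momFn
  split_ifs with h₁ h₂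
  · exact absurd h₂ hx.not_ge
  · rfl
  · rw [max_eq_right (by linarith), zero_pow (by omega)]

/-- To the right of `x`, the integrand `momFn n · x` is a pure power. -/
lemma momFn_of_le {n : ℕ} {η x : ℝ} (hx : x ≤ η) : momFn n η x = (η - x) ^ (n - 1) := by
  unfold momFn
  split_ifs with h₁
  · simp [h₁]
  · rw [max_eq_left (by linarith)]

/-- Powers of `b - X` are integrable for a random variable `X` with values in `[a, b]`. -/
lemma integrable_sub_pow_of_mem_Icc {Ω : Type*} [MeasurableSpace Ω] {μ : Measure Ω}
    [IsFiniteMeasure μ] {a b : ℝ} {X : Ω → ℝ} (hX : Measurable X)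
    (hXab : ∀ ω, X ω ∈ Set.Icc a b) (k : ℕ) :
    Integrable (fun ω => (b - X ω) ^ k) μ := by
  refine Integrable.of_bound (by fun_prop) ((b - a) ^ k) (ae_of_all _ fun ω => ?_)
  obtain ⟨h₁, h₂⟩ := hXab ω
  have h₃ : 0 ≤ b - X ω := sub_nonneg.2 h₂
  rw [Real.norm_of_nonneg (pow_nonneg h₃ k)]
  gcongr

/-- Binomial expansion of the moments of `η - X` around `b`. -/
lemma integral_sub_pow_eq_sum {Ω : Type*} [MeasurableSpace Ω] {μ : Measure Ω}
    [IsFiniteMeasure μ] {a b : ℝ} {X : Ω → ℝ} (hX : Measurable X)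
    (hXab : ∀ ω, X ω ∈ Set.Icc a b) (η : ℝ) (m : ℕ) :
    ∫ ω, (η - X ω) ^ m ∂μ = ∑ k ∈ Finset.range (m + 1),
      (∫ ω, (b - X ω) ^ k ∂μ) * ((η - b) ^ (m - k) * (m.choose k : ℝ)) := by
  simp_rw [← integral_mul_const]
  rw [← integral_finsetSum _ fun k _ =>
    (integrable_sub_pow_of_mem_Icc hX hXab k).mul_const _]
  congr 1 with ω
  rw [show η - X ω = (b - X ω) + (η - b) by ring, add_pow]
  simp_rw [mul_assoc]

theorem stmt_0 {Ω : Type*} [MeasurableSpace Ω] (μ : Measure Ω) [IsProbabilityMeasure μ]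
    (a b : ℝ) (hab : a < b) (n : ℕ) (hn : 1 ≤ n)
    (X Y : Ω → ℝ) (hX : Measurable X) (hY : Measurable Y)
    (hXab : ∀ ω, X ω ∈ Set.Icc a b) (hYab : ∀ ω, Y ω ∈ Set.Icc a b)
    (h : SDI μ X Y n a b) : SD μ X Y n := by
  intro η
  rcases lt_or_ge η a with hηa | hηa
  · simp_rw [fun ω => momFn_of_lt hn (hηa.trans_le (hXab ω).1),
      fun ω => momFn_of_lt hn (hηa.trans_le (hYab ω).1)]
    rfl
  rcases le_or_gt η b with hηb | hηb
  · exact h.1 η ⟨hηa, hηb⟩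
  simp_rw [fun ω => momFn_of_le (n := n) ((hXab ω).2.trans hηb.le),
    fun ω => momFn_of_le (n := n) ((hYab ω).2.trans hηb.le)]
  rw [integral_sub_pow_eq_sum hX hXab, integral_sub_pow_eq_sum hY hYab]
  refine Finset.sum_le_sum fun k hk => mul_le_mul_of_nonneg_right ?_ ?_
  · have hk' := Finset.mem_range.1 hk
    simpa using h.2 (k + 1) (Finset.mem_Icc.2 ⟨by omega, by omega⟩)
  · have := sub_nonneg.2 hηb.le
    positivity
end

section
/- Let n ≥ 1 be an integer. For bounded random variables X and Y, X dominates Y in nth-order stochastic dominance on ℝ (X ≥ₙ Y) if and only if E[u(X)] ≥ E[u(Y)] for every u ∈ 𝒰ₙ. -/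
open MeasureTheory Filter Set

/-- The class of `n`-times differentiable utilities `u` with
`(-1)^(k-1) * u^(k) ≥ 0` on `s` for all `k ∈ {1,…,n}`. -/
def UClass (n : ℕ) (s : Set ℝ) (u : ℝ → ℝ) : Prop :=
  (∀ k < n, Differentiable ℝ (iteratedDeriv k u)) ∧
  ∀ k ∈ Finset.Icc 1 n, ∀ x ∈ s, 0 ≤ (-1 : ℝ) ^ (k - 1) * iteratedDeriv k u x

open Nat in
lemma hasDerivAt_taylorSum {u : ℝ → ℝ} (m : ℕ)
    (hd : ∀ k < m + 1, Differentiable ℝ (iteratedDeriv k u)) (x t : ℝ) :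
    HasDerivAt (fun t => ∑ k ∈ Finset.range (m + 1), iteratedDeriv k u t / k ! * (x - t) ^ k)
      (iteratedDeriv (m + 1) u t / m ! * (x - t) ^ m) t := by
  have hk : ∀ k < m + 1, HasDerivAt (iteratedDeriv k u) (iteratedDeriv (k + 1) u t) t := by
    intro k hk
    rw [iteratedDeriv_succ]
    exact (hd k hk t).hasDerivAt
  induction m with
  | zero => simpa using hk 0 (by simp)
  | succ m ih =>
    have h1 := ih (fun k h => hd k (by omega)) (fun k h => hk k (by omega))
    have h2 := ((hk (m + 1) (by omega)).div_const ((m + 1)! : ℝ)).mul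
      (((hasDerivAt_id t).const_sub x).pow (m + 1))
    have h3 := h1.add h2
    have hfun : (fun t => ∑ k ∈ Finset.range (m + 1 + 1), iteratedDeriv k u t / k ! * (x - t) ^ k)
        = (fun t => ∑ k ∈ Finset.range (m + 1), iteratedDeriv k u t / k ! * (x - t) ^ k) +
          (fun t => iteratedDeriv (m + 1) u t / (m + 1)!) * (fun t => x - id t) ^ (m + 1) := by
      funext s
      rw [Finset.sum_range_succ]
      rfl
    rw [hfun]
    refine h3.congr_deriv ?_
    simp only [Pi.pow_apply, id, Nat.factorial_succ, Nat.add_sub_cancel]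
    push_cast
    field_simp
    ring

lemma UClass.intervalIntegrable {u : ℝ → ℝ} {m : ℕ} (hu : UClass (m + 1) univ u) (a b : ℝ) :
    IntervalIntegrable (iteratedDeriv (m + 1) u) volume a b := by
  have hder : ∀ t, HasDerivAt (fun t => (-1 : ℝ) ^ m * iteratedDeriv m u t)
      ((-1 : ℝ) ^ m * iteratedDeriv (m + 1) u t) t := by
    intro t
    rw [iteratedDeriv_succ]
    exact (hu.1 m (by omega) t).hasDerivAt.const_mul _
  have h : IntervalIntegrable (fun t => (-1 : ℝ) ^ m * iteratedDeriv (m + 1) u t) volume a b :=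
    intervalIntegral.intervalIntegrable_deriv_of_nonneg
      (fun t _ => (hder t).continuousAt.continuousWithinAt) (fun t _ => hder t)
      (fun t _ => by simpa using hu.2 (m + 1) (by simp) t (mem_univ t))
  convert h.const_mul ((-1 : ℝ) ^ m) using 2 with t
  rw [← mul_assoc, ← mul_pow]
  simp

lemma momFn_of_lt_s2 {m : ℕ} {t x : ℝ} (h : t < x) : momFn (m + 1) t x = 0 := by
  rcases m with - | m
  · simp [momFn, h]
  · simp [momFn, max_eq_right (sub_nonpos.2 h.le)]

lemma momFn_of_le_s2 {m : ℕ} {t x : ℝ} (h : x ≤ t) : momFn (m + 1) t x = (t - x) ^ m := by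
  rcases m with - | m
  · simp [momFn, h]
  · simp [momFn, max_eq_left (sub_nonneg.2 h)]

lemma momFn_nonneg (m : ℕ) (t x : ℝ) : 0 ≤ momFn (m + 1) t x := by
  rcases le_or_gt x t with h | h
  · rw [momFn_of_le_s2 h]
    exact pow_nonneg (sub_nonneg.2 h) m
  · rw [momFn_of_lt_s2 h]

lemma momFn_le (m : ℕ) {t x T C : ℝ} (ht : t ≤ T) (hx : |x| ≤ C) (hT : 0 ≤ T) :
    momFn (m + 1) t x ≤ (T + C) ^ m := by
  have := abs_le.1 hx
  rcases le_or_gt x t with h | h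
  · rw [momFn_of_le_s2 h]
    exact pow_le_pow_left₀ (sub_nonneg.2 h) (by linarith) m
  · rw [momFn_of_lt_s2 h]
    exact pow_nonneg (by linarith) m

lemma measurable_momFn (n : ℕ) : Measurable fun p : ℝ × ℝ => momFn n p.1 p.2 := by
  unfold momFn
  split_ifs with h
  · exact Measurable.ite (measurableSet_le measurable_snd measurable_fst)
      measurable_const measurable_const
  · fun_prop

open Nat in
lemma UClass.taylor_momFn {u : ℝ → ℝ} {m : ℕ} (hu : UClass (m + 1) univ u) {a r x : ℝ}
    (hax : a ≤ x) (hxr : x ≤ r) :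
    u x = ∑ k ∈ Finset.range (m + 1), iteratedDeriv k u r / k ! * (x - r) ^ k
      - ∫ t in a..r, (-1 : ℝ) ^ m * iteratedDeriv (m + 1) u t / m ! * momFn (m + 1) t x := by
  have hint : IntervalIntegrable (fun t => iteratedDeriv (m + 1) u t / m ! * (x - t) ^ m)
      volume x r :=
    ((hu.intervalIntegrable x r).div_const _).mul_continuousOn (by fun_prop)
  have hftc := intervalIntegral.integral_eq_sub_of_hasDerivAt
    (fun t _ => hasDerivAt_taylorSum m hu.1 x t) hint
  have hTx : ∑ k ∈ Finset.range (m + 1), iteratedDeriv k u x / k ! * (x - x) ^ k = u x := by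
    rw [Finset.sum_range_succ']
    simp
  have hright : EqOn (fun t => iteratedDeriv (m + 1) u t / m ! * (x - t) ^ m)
      (fun t => (-1 : ℝ) ^ m * iteratedDeriv (m + 1) u t / m ! * momFn (m + 1) t x)
      (uIcc x r) := by
    intro t ht
    rw [uIcc_of_le hxr] at ht
    simp only [momFn_of_le_s2 ht.1]
    rw [← neg_sub t x, neg_pow]
    ring
  have hleft : ∀ᵐ t : ℝ, t ∈ uIoc a x → (0 : ℝ) =
      (-1 : ℝ) ^ m * iteratedDeriv (m + 1) u t / m ! * momFn (m + 1) t x := by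
    filter_upwards [Measure.ae_ne volume x] with t htx ht
    rw [uIoc_of_le hax] at ht
    rw [momFn_of_lt_s2 (lt_of_le_of_ne ht.2 htx), mul_zero]
  have hleft_int : IntervalIntegrable
      (fun t => (-1 : ℝ) ^ m * iteratedDeriv (m + 1) u t / m ! * momFn (m + 1) t x)
      volume a x :=
    (intervalIntegrable_const (c := (0 : ℝ))).congr_ae
      ((ae_restrict_iff' measurableSet_uIoc).2 hleft)
  have hright_int : IntervalIntegrable
      (fun t => (-1 : ℝ) ^ m * iteratedDeriv (m + 1) u t / m ! * momFn (m + 1) t x)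
      volume x r :=
    hint.congr (fun t ht => hright (uIoc_subset_uIcc ht))
  rw [← intervalIntegral.integral_add_adjacent_intervals hleft_int hright_int,
    ← intervalIntegral.integral_congr_ae hleft, ← intervalIntegral.integral_congr hright, hftc, hTx]
  simp

section Expectation

variable {Ω : Type*} [MeasurableSpace Ω] {μ : Measure Ω} [IsProbabilityMeasure μ]

lemma integrable_of_continuous_comp {X : Ω → ℝ} (hX : Measurable X) {C : ℝ}
    (hC : ∀ ω, |X ω| ≤ C) {f : ℝ → ℝ} (hf : Continuous f) :
    Integrable (fun ω => f (X ω)) μ := by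
  obtain ⟨B, hB⟩ := (isCompact_Icc (a := -C) (b := C)).exists_bound_of_continuousOn hf.continuousOn
  exact Integrable.of_bound (hf.measurable.comp hX).aestronglyMeasurable B
    (ae_of_all _ fun ω => hB _ (abs_le.1 (hC ω)))

lemma integrable_prod_mul_momFn {X : Ω → ℝ} (hX : Measurable X) {C : ℝ} (hC : ∀ ω, |X ω| ≤ C)
    (m : ℕ) {w : ℝ → ℝ} {a b : ℝ} (hw : IntervalIntegrable w volume a b) :
    Integrable (Function.uncurry fun t ω => w t * momFn (m + 1) t (X ω))
      ((volume.restrict (uIoc a b)).prod μ) := by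
  have hw' : Integrable (fun z : ℝ × Ω => w z.1) ((volume.restrict (uIoc a b)).prod μ) :=
    hw.def'.comp_fst μ
  refine hw'.mul_bdd (c := (max |a| |b| + C) ^ m) ?_ ?_
  · exact ((measurable_momFn (m + 1)).comp
      (measurable_fst.prodMk (hX.comp measurable_snd))).aestronglyMeasurable
  · have hmem : ∀ᵐ z ∂((volume.restrict (uIoc a b)).prod μ), z.1 ∈ uIoc a b :=
      Measure.quasiMeasurePreserving_fst.ae (ae_restrict_mem measurableSet_uIoc)
    filter_upwards [hmem] with z hz
    rw [Real.norm_of_nonneg (momFn_nonneg m _ _)]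
    refine momFn_le m (hz.2.trans ?_) (hC z.2) (le_max_of_le_left (abs_nonneg a))
    exact max_le_max (le_abs_self a) (le_abs_self b)

open Nat in
lemma UClass.integral_eq {u : ℝ → ℝ} {m : ℕ} (hu : UClass (m + 1) univ u) {X : Ω → ℝ}
    (hX : Measurable X) {C : ℝ} (hC : ∀ ω, |X ω| ≤ C) {r : ℝ} (hr : C ≤ r) :
    ∫ ω, u (X ω) ∂μ =
      ∑ k ∈ Finset.range (m + 1), iteratedDeriv k u r / k ! * ∫ ω, (X ω - r) ^ k ∂μ
      - ∫ t in (-C)..r, (-1 : ℝ) ^ m * iteratedDeriv (m + 1) u t / m ! *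
          ∫ ω, momFn (m + 1) t (X ω) ∂μ := by
  have hprod := integrable_prod_mul_momFn (μ := μ) hX hC m
    (((hu.intervalIntegrable (-C) r).const_mul ((-1 : ℝ) ^ m)).div_const (m ! : ℝ))
  have hpow : ∀ k, Integrable (fun ω => (X ω - r) ^ k) μ := fun k =>
    integrable_of_continuous_comp hX hC (f := fun x => (x - r) ^ k) (by fun_prop)
  have hrem : Integrable (fun ω => ∫ t in (-C)..r,
      (-1 : ℝ) ^ m * iteratedDeriv (m + 1) u t / m ! * momFn (m + 1) t (X ω)) μ := by
    have h := hprod.integral_prod_right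
    have hle : -C ≤ r := by
      obtain ⟨ω⟩ : Nonempty Ω := nonempty_of_isProbabilityMeasure μ
      linarith [(abs_nonneg _).trans (hC ω)]
    simpa only [uIoc_of_le hle, ← intervalIntegral.integral_of_le hle,
      Function.uncurry_apply_pair] using h
  calc ∫ ω, u (X ω) ∂μ
      = ∫ ω, (∑ k ∈ Finset.range (m + 1), iteratedDeriv k u r / k ! * (X ω - r) ^ k
        - ∫ t in (-C)..r,
          (-1 : ℝ) ^ m * iteratedDeriv (m + 1) u t / m ! * momFn (m + 1) t (X ω)) ∂μ := by
        refine integral_congr_ae (ae_of_all _ fun ω => ?_)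
        exact hu.taylor_momFn (abs_le.1 (hC ω)).1 ((abs_le.1 (hC ω)).2.trans hr)
    _ = _ := by
        rw [integral_sub (integrable_finsetSum _ fun k _ => (hpow k).const_mul _) hrem,
          integral_finsetSum _ fun k _ => (hpow k).const_mul _,
          ← intervalIntegral_integral_swap hprod]
        simp_rw [integral_const_mul]

lemma intervalIntegrable_mul_integral_momFn {X : Ω → ℝ} (hX : Measurable X) {C : ℝ}
    (hC : ∀ ω, |X ω| ≤ C) (m : ℕ) {w : ℝ → ℝ} {a b : ℝ} (hw : IntervalIntegrable w volume a b) :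
    IntervalIntegrable (fun t => w t * ∫ ω, momFn (m + 1) t (X ω) ∂μ) volume a b := by
  have h := (integrable_prod_mul_momFn (μ := μ) hX hC m hw).integral_prod_left
  rw [intervalIntegrable_iff, IntegrableOn]
  simpa only [Function.uncurry, integral_const_mul] using h

lemma SD.integral_le {X Y : Ω → ℝ} {m : ℕ} (hm : 1 ≤ m) (h : SD μ X Y (m + 1))
    (hX : Measurable X) (hY : Measurable Y) {C : ℝ} (hXC : ∀ ω, |X ω| ≤ C)
    (hYC : ∀ ω, |Y ω| ≤ C) : ∫ ω, Y ω ∂μ ≤ ∫ ω, X ω ∂μ := by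
  have hXi : Integrable X μ := integrable_of_continuous_comp hX hXC continuous_id
  have hYi : Integrable Y μ := integrable_of_continuous_comp hY hYC continuous_id
  have hC0 : 0 ≤ C := by
    obtain ⟨ω⟩ : Nonempty Ω := nonempty_of_isProbabilityMeasure μ
    exact (abs_nonneg _).trans (hXC ω)
  have hlim : Tendsto (fun η : ℝ => ∫ ω, ((η - Y ω) ^ m - (η - X ω) ^ m) / η ^ (m - 1) ∂μ) atTop
      (nhds (∫ ω, m * (X ω - Y ω) ∂μ)) := by
    refine tendsto_integral_filter_of_dominated_convergence
      (fun _ => 2 * C * m * 2 ^ (m - 1)) (Eventually.of_forall fun η => ?_) ?_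
      (integrable_const _) (ae_of_all _ fun ω => ?_)
    · exact (((measurable_const.sub hY).pow_const m).sub
        ((measurable_const.sub hX).pow_const m)).div_const _ |>.aestronglyMeasurable
    · filter_upwards [eventually_ge_atTop C, eventually_gt_atTop 0] with η hη hη0
      refine ae_of_all _ fun ω => ?_
      have hx := abs_le.1 (hXC ω)
      have hy := abs_le.1 (hYC ω)
      rw [norm_div, norm_pow, Real.norm_of_nonneg hη0.le, div_le_iff₀ (by positivity)]
      calc ‖(η - Y ω) ^ m - (η - X ω) ^ m‖
          ≤ |(η - Y ω) - (η - X ω)| * m * max |η - Y ω| |η - X ω| ^ (m - 1) :=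
            abs_pow_sub_pow_le _ _ _
        _ ≤ 2 * C * m * (2 * η) ^ (m - 1) := by
            gcongr
            · exact abs_le.2 ⟨by linarith, by linarith⟩
            · exact max_le (abs_le.2 ⟨by linarith, by linarith⟩)
                (abs_le.2 ⟨by linarith, by linarith⟩)
        _ = _ := by rw [mul_pow]; ring
    · have hone : ∀ z : ℝ, Tendsto (fun η : ℝ => (η - z) / η) atTop (nhds 1) := by
        intro z
        have h0 : Tendsto (fun η : ℝ => 1 - z / η) atTop (nhds (1 - 0)) :=
          tendsto_const_nhds.sub (tendsto_const_nhds.div_atTop tendsto_id)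
        rw [sub_zero] at h0
        refine h0.congr' ?_
        filter_upwards [eventually_ne_atTop 0] with η hη
        field_simp
      have hsum : Tendsto (fun η : ℝ => (∑ i ∈ Finset.range m,
          ((η - Y ω) / η) ^ i * ((η - X ω) / η) ^ (m - 1 - i)) * (X ω - Y ω)) atTop
          (nhds ((∑ i ∈ Finset.range m, (1 : ℝ) ^ i * 1 ^ (m - 1 - i)) * (X ω - Y ω))) :=
        (tendsto_finsetSum _ fun i _ =>
          ((hone _).pow i).mul ((hone _).pow (m - 1 - i))).mul_const _
      simp only [one_pow, mul_one, Finset.sum_const, Finset.card_range, nsmul_eq_mul] at hsum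
      refine hsum.congr' ?_
      filter_upwards [eventually_ne_atTop 0] with η hη
      rw [eq_div_iff (pow_ne_zero _ hη), ← (Commute.all (η - Y ω) (η - X ω)).geom_sum₂_mul m,
        mul_right_comm, Finset.sum_mul]
      congr 1
      · refine Finset.sum_congr rfl fun i hi => ?_
        have hi' : m - 1 = i + (m - 1 - i) := by
          have := Finset.mem_range.1 hi
          omega
        nth_rewrite 2 [hi']
        rw [div_pow, div_pow, pow_add]
        field_simp
      · ring
  have hnonneg : 0 ≤ ∫ ω, m * (X ω - Y ω) ∂μ := by
    refine ge_of_tendsto hlim ?_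
    filter_upwards [eventually_ge_atTop C, eventually_gt_atTop 0] with η hη hη0
    rw [integral_div, integral_sub
      (integrable_of_continuous_comp hY hYC (f := fun y => (η - y) ^ m) (by fun_prop))
      (integrable_of_continuous_comp hX hXC (f := fun x => (η - x) ^ m) (by fun_prop))]
    have hη' := h η
    simp only [fun ω => momFn_of_le_s2 (m := m) ((abs_le.1 (hXC ω)).2.trans hη),
      fun ω => momFn_of_le_s2 (m := m) ((abs_le.1 (hYC ω)).2.trans hη)] at hη'
    exact div_nonneg (sub_nonneg.2 hη') (by positivity)
  rw [integral_const_mul, integral_sub hXi hYi] at hnonneg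
  exact sub_nonneg.1 (nonneg_of_mul_nonneg_right hnonneg (by exact_mod_cast hm))

end Expectation

lemma tendsto_pow_mul_of_hasDerivAt_neg {f : ℕ → ℝ → ℝ} {m : ℕ}
    (hder : ∀ j < m, ∀ t, HasDerivAt (f j) (-f (j + 1) t) t)
    (hpos : ∀ j ≤ m, ∀ t, 0 ≤ f j t) {L : ℝ} (hL : Tendsto (f 0) atTop (nhds L)) :
    ∀ j, j + 1 < m → Tendsto (fun r => r ^ (j + 1) * f (j + 1) r) atTop (nhds 0) := by
  have hanti : ∀ j < m, Antitone (f j) := fun j hj =>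
    antitone_of_hasDerivAt_nonpos (hder j hj) fun t => neg_nonpos.2 (hpos (j + 1) hj t)
  have hhalf : Tendsto (fun r : ℝ => r / 2) atTop atTop := tendsto_id.atTop_div_const two_pos
  have hbound : ∀ j, j + 1 < m → ∀ r > 0,
      r ^ (j + 1) * f (j + 1) r ≤ 2 * (2 ^ j * ((r / 2) ^ j * f j (r / 2)) - r ^ j * f j r) := by
    intro j hj r hr
    obtain ⟨c, hc, hslope⟩ := exists_hasDerivAt_eq_slope (f j) (fun t => -f (j + 1) t)
      (half_lt_self hr) (fun t _ => (hder j (by omega) t).continuousAt.continuousWithinAt)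
      (fun t _ => hder j (by omega) t)
    have hc' : f (j + 1) r ≤ f (j + 1) c := hanti (j + 1) hj hc.2.le
    rw [eq_div_iff (by linarith)] at hslope
    have h1 : r * f (j + 1) r ≤ 2 * (f j (r / 2) - f j r) := by nlinarith
    have h2 := mul_le_mul_of_nonneg_left h1 (pow_nonneg hr.le j)
    rw [div_pow]
    calc r ^ (j + 1) * f (j + 1) r = r ^ j * (r * f (j + 1) r) := by ring
      _ ≤ _ := h2
      _ = _ := by field_simp
  intro j
  induction j with
  | zero =>
    intro hj
    have hz : Tendsto (fun r => 2 * (2 ^ 0 * ((r / 2) ^ 0 * f 0 (r / 2)) - r ^ 0 * f 0 r))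
        atTop (nhds 0) := by
      simpa using ((hL.comp hhalf).sub hL).const_mul 2
    refine squeeze_zero' ?_ ?_ hz
    · filter_upwards [eventually_gt_atTop 0] with r hr
      exact mul_nonneg (by positivity) (hpos _ hj.le r)
    · filter_upwards [eventually_gt_atTop 0] with r hr using hbound 0 hj r hr
  | succ j ih =>
    intro hj
    have hi := ih (by omega)
    have hz : Tendsto (fun r => 2 * (2 ^ (j + 1) * ((r / 2) ^ (j + 1) * f (j + 1) (r / 2))
        - r ^ (j + 1) * f (j + 1) r)) atTop (nhds 0) := by
      simpa using (((hi.comp hhalf).const_mul (2 ^ (j + 1))).sub hi).const_mul 2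
    refine squeeze_zero' ?_ ?_ hz
    · filter_upwards [eventually_gt_atTop 0] with r hr
      exact mul_nonneg (by positivity) (hpos _ hj.le r)
    · filter_upwards [eventually_gt_atTop 0] with r hr using hbound (j + 1) hj r hr

lemma UClass.hasDerivAt_signed {u : ℝ → ℝ} {m : ℕ} (hu : UClass (m + 1) univ u) :
    ∀ j < m, ∀ t, HasDerivAt (fun t => (-1 : ℝ) ^ j * iteratedDeriv (j + 1) u t)
      (-((-1 : ℝ) ^ (j + 1) * iteratedDeriv (j + 1 + 1) u t)) t := by
  intro j hj t
  have h := (hu.1 (j + 1) (by omega) t).hasDerivAt.const_mul ((-1 : ℝ) ^ j)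
  rw [← iteratedDeriv_succ] at h
  exact h.congr_deriv (by ring)

lemma UClass.signed_nonneg {u : ℝ → ℝ} {m : ℕ} (hu : UClass (m + 1) univ u) :
    ∀ j ≤ m, ∀ t, 0 ≤ (-1 : ℝ) ^ j * iteratedDeriv (j + 1) u t := fun j hj t => by
  simpa using hu.2 (j + 1) (by simpa using hj) t (mem_univ t)

lemma UClass.exists_tendsto_deriv {u : ℝ → ℝ} {m : ℕ} (hu : UClass (m + 1) univ u) (hm : 1 ≤ m) :
    ∃ L, 0 ≤ L ∧ Tendsto (iteratedDeriv 1 u) atTop (nhds L) := by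
  have hpos : ∀ t, 0 ≤ iteratedDeriv 1 u t := fun t => by
    simpa using hu.signed_nonneg 0 (by omega) t
  have hanti : Antitone (iteratedDeriv 1 u) := by
    have h : Antitone fun t => (-1 : ℝ) ^ 0 * iteratedDeriv (0 + 1) u t :=
      antitone_of_hasDerivAt_nonpos (hu.hasDerivAt_signed 0 hm)
        fun t => neg_nonpos.2 (hu.signed_nonneg 1 hm t)
    simpa only [pow_zero, one_mul, zero_add] using h
  have hlim := tendsto_atTop_ciInf hanti ⟨0, by rintro _ ⟨t, rfl⟩; exact hpos t⟩
  exact ⟨_, le_ciInf hpos, hlim⟩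

lemma UClass.tendsto_pow_mul_iteratedDeriv {u : ℝ → ℝ} {m : ℕ} (hu : UClass (m + 1) univ u)
    {j : ℕ} (hj : j + 1 < m) :
    Tendsto (fun r => r ^ (j + 1) * |iteratedDeriv (j + 2) u r|) atTop (nhds 0) := by
  obtain ⟨L, -, hL⟩ := hu.exists_tendsto_deriv (by omega)
  have h := tendsto_pow_mul_of_hasDerivAt_neg (m := m)
    (f := fun j t => (-1 : ℝ) ^ j * iteratedDeriv (j + 1) u t) hu.hasDerivAt_signed
    hu.signed_nonneg (L := L) (by simpa using hL) j hj
  refine h.congr fun r => ?_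
  rw [← abs_of_nonneg (hu.signed_nonneg (j + 1) hj.le r), abs_mul, abs_pow]
  simp

section UtilityFromDominance

variable {Ω : Type*} [MeasurableSpace Ω] {μ : Measure Ω} [IsProbabilityMeasure μ]

lemma abs_integral_pow_sub_integral_pow_le {X Y : Ω → ℝ} (hX : Measurable X) (hY : Measurable Y)
    {C : ℝ} (hXC : ∀ ω, |X ω| ≤ C) (hYC : ∀ ω, |Y ω| ≤ C) (k : ℕ) {r : ℝ} (hr : C ≤ r) :
    |∫ ω, (X ω - r) ^ k ∂μ - ∫ ω, (Y ω - r) ^ k ∂μ| ≤ 2 * C * k * 2 ^ (k - 1) * r ^ (k - 1) := by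
  rw [← integral_sub
    (integrable_of_continuous_comp hX hXC (f := fun x => (x - r) ^ k) (by fun_prop))
    (integrable_of_continuous_comp hY hYC (f := fun y => (y - r) ^ k) (by fun_prop))]
  have hbound : ∀ ω, ‖(X ω - r) ^ k - (Y ω - r) ^ k‖ ≤ 2 * C * k * 2 ^ (k - 1) * r ^ (k - 1) := by
    intro ω
    have hx := abs_le.1 (hXC ω)
    have hy := abs_le.1 (hYC ω)
    have hC0 : 0 ≤ C := (abs_nonneg _).trans (hXC ω)
    calc ‖(X ω - r) ^ k - (Y ω - r) ^ k‖
        ≤ |(X ω - r) - (Y ω - r)| * k * max |X ω - r| |Y ω - r| ^ (k - 1) :=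
          abs_pow_sub_pow_le _ _ _
      _ ≤ 2 * C * k * (2 * r) ^ (k - 1) := by
          gcongr
          · exact abs_le.2 ⟨by linarith, by linarith⟩
          · exact max_le (abs_le.2 ⟨by linarith, by linarith⟩)
              (abs_le.2 ⟨by linarith, by linarith⟩)
      _ = _ := by rw [mul_pow]; ring
  simpa using norm_integral_le_of_norm_le_const (μ := μ) (ae_of_all _ hbound)

open Nat in
lemma UClass.exists_tendsto_taylor_term {u : ℝ → ℝ} {m : ℕ} (hu : UClass (m + 1) univ u)
    {X Y : Ω → ℝ} (hX : Measurable X) (hY : Measurable Y) {C : ℝ} (hXC : ∀ ω, |X ω| ≤ C)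
    (hYC : ∀ ω, |Y ω| ≤ C) (h : SD μ X Y (m + 1)) (k : ℕ) (hk : k < m + 1) :
    ∃ L, 0 ≤ L ∧ Tendsto (fun r => iteratedDeriv k u r / k ! *
      (∫ ω, (X ω - r) ^ k ∂μ - ∫ ω, (Y ω - r) ^ k ∂μ)) atTop (nhds L) := by
  match k, hk with
  | 0, _ => exact ⟨0, le_rfl, by simp⟩
  | 1, hk =>
    obtain ⟨L, hL0, hL⟩ := hu.exists_tendsto_deriv (by omega)
    have hmean := h.integral_le (by omega) hX hY hXC hYC
    refine ⟨L * (∫ ω, X ω ∂μ - ∫ ω, Y ω ∂μ), mul_nonneg hL0 (sub_nonneg.2 hmean), ?_⟩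
    refine (hL.mul_const _).congr fun r => ?_
    have hXi : Integrable X μ := integrable_of_continuous_comp hX hXC continuous_id
    have hYi : Integrable Y μ := integrable_of_continuous_comp hY hYC continuous_id
    simp only [pow_one]
    rw [integral_sub hXi (integrable_const r), integral_sub hYi (integrable_const r)]
    simp
  | j + 2, hk =>
    refine ⟨0, le_rfl, ?_⟩
    have hz := (hu.tendsto_pow_mul_iteratedDeriv (j := j) (by omega)).const_mul
      (2 * C * (j + 2 : ℕ) * 2 ^ (j + 1) / (j + 2)!)
    rw [mul_zero] at hz
    refine squeeze_zero_norm' ?_ hz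
    filter_upwards [eventually_ge_atTop C] with r hr
    have hb := abs_integral_pow_sub_integral_pow_le (μ := μ) hX hY hXC hYC (j + 2) hr
    rw [norm_mul, norm_div, Real.norm_eq_abs, Real.norm_eq_abs, Real.norm_eq_abs,
      Nat.abs_cast]
    calc _ ≤ |iteratedDeriv (j + 2) u r| / (j + 2)! *
          (2 * C * (j + 2 : ℕ) * 2 ^ (j + 2 - 1) * r ^ (j + 2 - 1)) := by gcongr
      _ = _ := by
        rw [show j + 2 - 1 = j + 1 by omega]
        ring

open Nat in
lemma SD.integral_comp_le {X Y : Ω → ℝ} {m : ℕ} (h : SD μ X Y (m + 1)) (hX : Measurable X)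
    (hY : Measurable Y) {C : ℝ} (hXC : ∀ ω, |X ω| ≤ C) (hYC : ∀ ω, |Y ω| ≤ C) {u : ℝ → ℝ}
    (hu : UClass (m + 1) univ u) : ∫ ω, u (Y ω) ∂μ ≤ ∫ ω, u (X ω) ∂μ := by
  have hC0 : 0 ≤ C := by
    obtain ⟨ω⟩ : Nonempty Ω := nonempty_of_isProbabilityMeasure μ
    exact (abs_nonneg _).trans (hXC ω)
  have hterm := hu.exists_tendsto_taylor_term hX hY hXC hYC h
  choose! L hL0 hL using hterm
  have hsum := tendsto_finsetSum (Finset.range (m + 1)) fun k hk => hL k (Finset.mem_range.1 hk)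
  have hle : ∑ k ∈ Finset.range (m + 1), L k ≤ ∫ ω, u (X ω) ∂μ - ∫ ω, u (Y ω) ∂μ := by
    refine le_of_tendsto hsum ?_
    filter_upwards [eventually_ge_atTop C] with r hr
    have hw := ((hu.intervalIntegrable (-C) r).const_mul ((-1 : ℝ) ^ m)).div_const (m ! : ℝ)
    have hmono := intervalIntegral.integral_mono_on (by linarith)
      (intervalIntegrable_mul_integral_momFn (μ := μ) hX hXC m hw)
      (intervalIntegrable_mul_integral_momFn (μ := μ) hY hYC m hw) fun t _ =>
        mul_le_mul_of_nonneg_left (h t)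
          (div_nonneg (hu.signed_nonneg m le_rfl t) (Nat.cast_nonneg _))
    rw [hu.integral_eq hX hXC hr, hu.integral_eq hY hYC hr]
    simp_rw [mul_sub, Finset.sum_sub_distrib]
    linarith
  exact sub_nonneg.1 ((Finset.sum_nonneg fun k hk => hL0 k (Finset.mem_range.1 hk)).trans hle)

end UtilityFromDominance

/-- The `k`-fold iterate of the tail integral `f ↦ fun x => ∫ t in x..R, f t`. -/
noncomputable def iterTail (f : ℝ → ℝ) (R : ℝ) : ℕ → ℝ → ℝ
  | 0 => f
  | k + 1 => fun x => ∫ t in x..R, iterTail f R k t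

section DominanceFromUtility

variable {f : ℝ → ℝ} {R : ℝ}

lemma continuous_iterTail (hf : Continuous f) (k : ℕ) : Continuous (iterTail f R k) := by
  induction k with
  | zero => exact hf
  | succ k ih =>
    exact continuous_iff_continuousAt.2 fun x => (HasDerivAt.continuousAt <|
      intervalIntegral.integral_hasDerivAt_left (ih.intervalIntegrable x R)
        (ih.stronglyMeasurableAtFilter _ _) ih.continuousAt)

lemma hasDerivAt_iterTail (hf : Continuous f) (k : ℕ) (x : ℝ) :
    HasDerivAt (iterTail f R (k + 1)) (-iterTail f R k x) x :=
  have hc := continuous_iterTail (R := R) hf k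
  intervalIntegral.integral_hasDerivAt_left (hc.intervalIntegrable x R)
    (hc.stronglyMeasurableAtFilter _ _) hc.continuousAt

lemma iterTail_eq_zero (hfR : ∀ x, R ≤ x → f x = 0) (k : ℕ) {x : ℝ} (hx : R ≤ x) :
    iterTail f R k x = 0 := by
  induction k generalizing x with
  | zero => exact hfR x hx
  | succ k ih =>
    have hcongr : EqOn (iterTail f R k) (fun _ => 0) (uIcc x R) := fun t ht => by
      rw [uIcc_of_ge hx] at ht
      exact ih ht.1
    simp only [iterTail, intervalIntegral.integral_congr hcongr, intervalIntegral.integral_zero]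

lemma iterTail_nonneg (hf0 : ∀ x, 0 ≤ f x) (hfR : ∀ x, R ≤ x → f x = 0) (k : ℕ) (x : ℝ) :
    0 ≤ iterTail f R k x := by
  induction k generalizing x with
  | zero => exact hf0 x
  | succ k ih =>
    rcases le_total x R with hx | hx
    · exact intervalIntegral.integral_nonneg hx fun t _ => ih t
    · rw [iterTail_eq_zero hfR _ hx]

lemma iteratedDeriv_neg_iterTail (hf : Continuous f) (j k : ℕ) :
    iteratedDeriv k (fun x => -iterTail f R (j + k) x) =
      fun x => (-1 : ℝ) ^ (k + 1) * iterTail f R j x := by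
  induction k generalizing j with
  | zero => simp
  | succ k ih =>
    have h := ih (j + 1)
    rw [show j + 1 + k = j + (k + 1) by omega] at h
    rw [iteratedDeriv_succ, h]
    funext x
    rw [((hasDerivAt_iterTail hf j x).const_mul ((-1 : ℝ) ^ (k + 1))).deriv]
    ring

lemma uClass_neg_iterTail (hf : Continuous f) (hf0 : ∀ x, 0 ≤ f x)
    (hfR : ∀ x, R ≤ x → f x = 0) (n : ℕ) : UClass n univ fun x => -iterTail f R n x := by
  constructor
  · intro k hk
    obtain ⟨j, rfl⟩ := Nat.exists_eq_add_of_lt hk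
    rw [show k + j + 1 = j + 1 + k by omega, iteratedDeriv_neg_iterTail hf (j + 1) k]
    exact fun x => ((hasDerivAt_iterTail hf j x).const_mul _).differentiableAt
  · intro k hk x _
    rw [Finset.mem_Icc] at hk
    obtain ⟨j, rfl⟩ := Nat.exists_eq_add_of_le' hk.2
    obtain ⟨i, rfl⟩ := Nat.exists_eq_add_of_le' hk.1
    rw [iteratedDeriv_neg_iterTail hf j (i + 1)]
    have hs : (-1 : ℝ) ^ (i + 1 - 1) * (-1) ^ (i + 1 + 1) = 1 := by
      rw [Nat.add_sub_cancel, ← pow_add]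
      exact Even.neg_one_pow ⟨i + 1, by ring⟩
    rw [← mul_assoc, hs, one_mul]
    exact iterTail_nonneg hf0 hfR j x

variable {Ω : Type*} [MeasurableSpace Ω] {μ : Measure Ω} [IsProbabilityMeasure μ]

open Nat in
lemma integral_neg_iterTail (hf : Continuous f) (hf0 : ∀ x, 0 ≤ f x)
    (hfR : ∀ x, R ≤ x → f x = 0) (m : ℕ) {X : Ω → ℝ} (hX : Measurable X) {C : ℝ}
    (hC : ∀ ω, |X ω| ≤ C) (hR : C ≤ R) :
    ∫ ω, -iterTail f R (m + 1) (X ω) ∂μ =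
      -∫ t in (-C)..R, f t / m ! * ∫ ω, momFn (m + 1) t (X ω) ∂μ := by
  rw [(uClass_neg_iterTail hf hf0 hfR (m + 1)).integral_eq hX hC hR]
  have hpoly : ∑ k ∈ Finset.range (m + 1),
      iteratedDeriv k (fun x => -iterTail f R (m + 1) x) R / k ! * ∫ ω, (X ω - R) ^ k ∂μ = 0 := by
    refine Finset.sum_eq_zero fun k hk => ?_
    obtain ⟨j, hj⟩ := Nat.exists_eq_add_of_le' (Finset.mem_range.1 hk).le
    rw [hj, iteratedDeriv_neg_iterTail hf j k]
    simp [iterTail_eq_zero hfR j le_rfl]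
  have htop := iteratedDeriv_neg_iterTail (R := R) hf 0 (m + 1)
  rw [zero_add] at htop
  have hs : (-1 : ℝ) ^ m * (-1) ^ (m + 1 + 1) = 1 := by
    rw [← pow_add]
    exact Even.neg_one_pow ⟨m + 1, by ring⟩
  rw [hpoly, htop, zero_sub]
  simp_rw [← mul_assoc, hs, one_mul]
  rfl

lemma tendsto_integral_momFn {X : Ω → ℝ} (hX : Measurable X) {C : ℝ} (hC : ∀ ω, |X ω| ≤ C)
    (m : ℕ) (η : ℝ) :
    Tendsto (fun t => ∫ ω, momFn (m + 1) t (X ω) ∂μ) (nhdsWithin η (Ici η))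
      (nhds (∫ ω, momFn (m + 1) η (X ω) ∂μ)) := by
  refine tendsto_integral_filter_of_dominated_convergence (fun _ => (|η| + 1 + C) ^ m)
    (Eventually.of_forall fun t => ?_) ?_ (integrable_const _) (ae_of_all _ fun ω => ?_)
  · exact ((measurable_momFn (m + 1)).comp
      (measurable_const.prodMk hX)).aestronglyMeasurable
  · have hlt : ∀ᶠ t in nhdsWithin η (Ici η), t < η + 1 :=
      nhdsWithin_le_nhds (eventually_lt_nhds (by linarith))
    filter_upwards [hlt] with t ht
    refine ae_of_all _ fun ω => ?_
    rw [Real.norm_of_nonneg (momFn_nonneg m _ _)]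
    exact momFn_le m (by linarith [le_abs_self η]) (hC ω) (by positivity)
  · rcases le_or_gt (X ω) η with hx | hx
    · rw [momFn_of_le_s2 hx]
      have hcont : Continuous fun t : ℝ => (t - X ω) ^ m := by fun_prop
      refine (hcont.tendsto η |>.mono_left nhdsWithin_le_nhds).congr' ?_
      filter_upwards [self_mem_nhdsWithin] with t ht
      rw [momFn_of_le_s2 (hx.trans ht)]
    · rw [momFn_of_lt_s2 hx]
      refine tendsto_const_nhds.congr' ?_
      filter_upwards [nhdsWithin_le_nhds (eventually_lt_nhds hx)] with t ht
      rw [momFn_of_lt_s2 ht]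

open Nat in
lemma SD.of_integral_comp_le {X Y : Ω → ℝ} {m : ℕ} (hX : Measurable X) (hY : Measurable Y)
    {C : ℝ} (hXC : ∀ ω, |X ω| ≤ C) (hYC : ∀ ω, |Y ω| ≤ C)
    (h : ∀ u : ℝ → ℝ, UClass (m + 1) univ u → ∫ ω, u (Y ω) ∂μ ≤ ∫ ω, u (X ω) ∂μ) :
    SD μ X Y (m + 1) := by
  intro η
  by_contra! hlt
  have hev := (tendsto_integral_momFn (μ := μ) hY hYC m η).eventually_lt
    (tendsto_integral_momFn (μ := μ) hX hXC m η) hlt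
  obtain ⟨b, hb, hsub⟩ := mem_nhdsGE_iff_exists_Ico_subset.1 hev
  rw [mem_Ioi] at hb
  set D := max C |η|
  set R := max D b
  have hXD : ∀ ω, |X ω| ≤ D := fun ω => (hXC ω).trans (le_max_left _ _)
  have hYD : ∀ ω, |Y ω| ≤ D := fun ω => (hYC ω).trans (le_max_left _ _)
  have hηD : |η| ≤ D := le_max_right _ _
  have hDR : D ≤ R := le_max_left _ _
  have hbR : b ≤ R := le_max_right _ _
  set f : ℝ → ℝ := fun t => max 0 ((t - η) * (b - t))
  have hf : Continuous f := by fun_prop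
  have hf0 : ∀ t, 0 ≤ f t := fun t => le_max_left _ _
  have hfzero : ∀ t, t ∉ Ioo η b → f t = 0 := by
    intro t ht
    refine max_eq_left ?_
    rcases le_or_gt t η with h1 | h1
    · exact mul_nonpos_of_nonpos_of_nonneg (by linarith) (by linarith)
    · have h2 : b ≤ t := not_lt.1 fun h2 => ht ⟨h1, h2⟩
      exact mul_nonpos_of_nonneg_of_nonpos (by linarith) (by linarith)
  have hfpos : ∀ t ∈ Ioo η b, 0 < f t := fun t ht =>
    lt_max_of_lt_right (mul_pos (sub_pos.2 ht.1) (sub_pos.2 ht.2))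
  have hfR : ∀ t, R ≤ t → f t = 0 := fun t ht =>
    hfzero t fun h' => absurd h'.2 (not_lt.2 (hbR.trans ht))
  have hu := h _ (uClass_neg_iterTail hf hf0 hfR (m + 1))
  rw [integral_neg_iterTail hf hf0 hfR m hX hXD hDR,
    integral_neg_iterTail hf hf0 hfR m hY hYD hDR, neg_le_neg_iff] at hu
  have hw : IntervalIntegrable (fun t => f t / m !) volume (-D) R :=
    (hf.div_const _).intervalIntegrable _ _
  have hIX := intervalIntegrable_mul_integral_momFn (μ := μ) hX hXD m hw
  have hIY := intervalIntegrable_mul_integral_momFn (μ := μ) hY hYD m hw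
  have hfac : (0 : ℝ) < m ! := by positivity
  have hpos : ∀ t ∈ Ioo η b, 0 < f t / m ! * ∫ ω, momFn (m + 1) t (X ω) ∂μ
      - f t / m ! * ∫ ω, momFn (m + 1) t (Y ω) ∂μ := fun t ht => by
    rw [← mul_sub]
    exact mul_pos (div_pos (hfpos t ht) hfac) (sub_pos.2 (hsub ⟨ht.1.le, ht.2⟩))
  have hint : 0 < ∫ t in (-D)..R, (f t / m ! * ∫ ω, momFn (m + 1) t (X ω) ∂μ
      - f t / m ! * ∫ ω, momFn (m + 1) t (Y ω) ∂μ) := by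
    rw [intervalIntegral.integral_pos_iff_support_of_nonneg_ae _ (hIX.sub hIY)]
    · have hDη := (abs_le.1 hηD).1
      refine ⟨by linarith, lt_of_lt_of_le ?_ (measure_mono (s := Ioo η b) fun t ht =>
        ⟨(hpos t ht).ne', by linarith [ht.1], ht.2.le.trans hbR⟩)⟩
      simpa using hb
    · refine ae_of_all _ fun t => ?_
      by_cases ht : t ∈ Ioo η b
      · exact (hpos t ht).le
      · simp [hfzero t ht]
  rw [intervalIntegral.integral_sub hIX hIY] at hint
  linarith

end DominanceFromUtility

theorem stmt_2 {Ω : Type*} [MeasurableSpace Ω] (μ : Measure Ω) [IsProbabilityMeasure μ]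
    (n : ℕ) (hn : 1 ≤ n)
    (X Y : Ω → ℝ) (hX : Measurable X) (hY : Measurable Y)
    (hXb : ∃ C, ∀ ω, |X ω| ≤ C) (hYb : ∃ C, ∀ ω, |Y ω| ≤ C) :
    SD μ X Y n ↔
      ∀ u : ℝ → ℝ, UClass n Set.univ u →
        (∫ ω, u (Y ω) ∂μ) ≤ ∫ ω, u (X ω) ∂μ := by
  obtain ⟨m, rfl⟩ := Nat.exists_eq_add_of_le' hn
  obtain ⟨A, hA⟩ := hXb
  obtain ⟨B, hB⟩ := hYb
  have hXC : ∀ ω, |X ω| ≤ max A B := fun ω => (hA ω).trans (le_max_left _ _)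
  have hYC : ∀ ω, |Y ω| ≤ max A B := fun ω => (hB ω).trans (le_max_right _ _)
  exact ⟨fun h u hu => h.integral_comp_le hX hY hXC hYC hu,
    fun h => SD.of_integral_comp_le hX hY hXC hYC h⟩
end

section
/- Let n ≥ 3 be an integer. For bounded random variables X and Y, X dominates Y in nth-order stochastic dominance on ℝ (X ≥ₙ Y) if and only if E[u(X)] ≥ E[u(Y)] for every function u : ℝ → ℝ that is (n−2)-times differentiable with (−1)^{k−1} u^{(k)} ≥ 0 on ℝ for all k ∈ {1,…,n−2} and such that (−1)^{n−2} u^{(n−2)} is increasing and concave on ℝ. -/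
open MeasureTheory Filter Set

/-- The closure class: `u` is (n-2)-times differentiable, `(-1)^(k-1) * u^(k) ≥ 0` on ℝ
for all `k ∈ {1,…,n-2}`, and `(-1)^(n-2) * u^(n-2)` is increasing and concave on ℝ. -/
def UBar (n : ℕ) (u : ℝ → ℝ) : Prop :=
  (∀ k < n - 2, Differentiable ℝ (iteratedDeriv k u)) ∧
  (∀ k ∈ Finset.Icc 1 (n - 2), ∀ x : ℝ, 0 ≤ (-1 : ℝ) ^ (k - 1) * iteratedDeriv k u x) ∧
  Monotone (fun x => (-1 : ℝ) ^ (n - 2) * iteratedDeriv (n - 2) u x) ∧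
  ConcaveOn ℝ Set.univ (fun x => (-1 : ℝ) ^ (n - 2) * iteratedDeriv (n - 2) u x)

/-! ### Integrals of functions of bounded random variables -/

lemma integrable_comp_of_bounded {Ω : Type*} [MeasurableSpace Ω] {μ : Measure Ω}
    [IsFiniteMeasure μ] {Z : Ω → ℝ} (hZ : Measurable Z) (hZb : ∃ C, ∀ ω, |Z ω| ≤ C)
    {f : ℝ → ℝ} (hf : Continuous f) : Integrable (fun ω => f (Z ω)) μ := by
  obtain ⟨C, hC⟩ := hZb
  obtain ⟨B, hB⟩ := (isCompact_Icc (a := -C) (b := C)).exists_bound_of_continuousOn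
    hf.continuousOn
  exact Integrable.of_bound (hf.measurable.comp hZ).aestronglyMeasurable B
    (Eventually.of_forall fun ω => hB _ (abs_le.1 (hC ω)))

/-! ### Moments around a far away point -/

section Moments

open Polynomial

lemma eventually_eval_nonneg_iff (P : ℝ[X]) :
    (∀ᶠ r in atTop, 0 ≤ P.eval r) ↔ 0 ≤ P.leadingCoeff := by
  rcases Nat.eq_zero_or_pos P.natDegree with h | h
  · rw [eq_C_of_natDegree_eq_zero h]
    simp only [eval_C, leadingCoeff_C, eventually_const]
  · have hd := natDegree_pos_iff_degree_pos.1 h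
    constructor
    · intro he
      by_contra! hlt
      have ht := P.tendsto_atBot_of_leadingCoeff_nonpos hd hlt.le
      obtain ⟨r, h1, h2⟩ := (he.and (ht.eventually_lt_atBot 0)).exists
      linarith
    · intro hl
      exact (P.tendsto_atTop_of_leadingCoeff_nonneg hd hl).eventually_ge_atTop 0

lemma eventually_eval_derivative_nonneg {P : ℝ[X]} (h : ∀ᶠ r in atTop, 0 ≤ P.eval r) :
    ∀ᶠ r in atTop, 0 ≤ P.derivative.eval r := by
  rw [eventually_eval_nonneg_iff] at h ⊢
  rw [leadingCoeff_derivative]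
  positivity

/-- The polynomial `r ↦ E[(r - Z)^k]`. -/
noncomputable def momentPoly {Ω : Type*} [MeasurableSpace Ω] (μ : Measure Ω) (Z : Ω → ℝ)
    (k : ℕ) : ℝ[X] :=
  ∑ i ∈ Finset.range (k + 1), C (∫ ω, (-Z ω) ^ (k - i) * (k.choose i : ℝ) ∂μ) * X ^ i

lemma coeff_momentPoly {Ω : Type*} [MeasurableSpace Ω] (μ : Measure Ω) (Z : Ω → ℝ) (k i : ℕ) :
    (momentPoly μ Z k).coeff i = (∫ ω, (-Z ω) ^ (k - i) ∂μ) * (k.choose i : ℝ) := by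
  rw [momentPoly]
  simp only [finsetSum_coeff, coeff_C_mul, coeff_X_pow, integral_mul_const]
  by_cases h : i ∈ Finset.range (k + 1)
  · simp [Finset.sum_ite_eq, h]
  · have : k.choose i = 0 := Nat.choose_eq_zero_of_lt (by simpa using h)
    simp [Finset.sum_ite_eq, this]

lemma derivative_momentPoly {Ω : Type*} [MeasurableSpace Ω] (μ : Measure Ω) (Z : Ω → ℝ) (k : ℕ) :
    (momentPoly μ Z (k + 1)).derivative = C ((k : ℝ) + 1) * momentPoly μ Z k := by
  ext i
  have h : ((k : ℝ) + 1) * (k.choose i : ℝ) = ((k + 1).choose (i + 1) : ℝ) * ((i : ℝ) + 1) := by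
    exact_mod_cast Nat.add_one_mul_choose_eq k i
  rw [coeff_derivative, coeff_C_mul, coeff_momentPoly, coeff_momentPoly, Nat.add_sub_add_right,
    mul_assoc, ← h]
  ring

lemma eval_momentPoly {Ω : Type*} [MeasurableSpace Ω] {μ : Measure Ω} [IsFiniteMeasure μ]
    {Z : Ω → ℝ} (hZ : Measurable Z) (hZb : ∃ C, ∀ ω, |Z ω| ≤ C) (k : ℕ) (r : ℝ) :
    (momentPoly μ Z k).eval r = ∫ ω, (r - Z ω) ^ k ∂μ := by
  simp only [sub_eq_add_neg, add_pow]
  rw [integral_finsetSum]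
  · rw [momentPoly, eval_finsetSum]
    refine Finset.sum_congr rfl fun i _ => ?_
    simp only [eval_mul, eval_C, eval_pow, eval_X, mul_assoc]
    rw [integral_const_mul, mul_comm]
  · intro i _
    exact integrable_comp_of_bounded hZ hZb
      (f := fun z => r ^ i * (-z) ^ (k - i) * (k.choose i : ℝ)) (by fun_prop)

lemma eventually_moment_le {Ω : Type*} [MeasurableSpace Ω] {μ : Measure Ω} [IsFiniteMeasure μ]
    {X Y : Ω → ℝ} (hX : Measurable X) (hY : Measurable Y)
    (hXb : ∃ C, ∀ ω, |X ω| ≤ C) (hYb : ∃ C, ∀ ω, |Y ω| ≤ C) {N : ℕ}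
    (h : ∀ᶠ r in atTop, ∫ ω, (r - X ω) ^ N ∂μ ≤ ∫ ω, (r - Y ω) ^ N ∂μ) {k : ℕ} (hk : k ≤ N) :
    ∀ᶠ r in atTop, ∫ ω, (r - X ω) ^ k ∂μ ≤ ∫ ω, (r - Y ω) ^ k ∂μ := by
  induction hk using Nat.decreasingInduction with
  | self => exact h
  | of_succ k _ ih =>
    have hd : ∀ᶠ r in atTop,
        0 ≤ (momentPoly μ Y (k + 1) - momentPoly μ X (k + 1)).derivative.eval r := by
      refine eventually_eval_derivative_nonneg ?_
      filter_upwards [ih] with r hr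
      rw [eval_sub, eval_momentPoly hX hXb, eval_momentPoly hY hYb]
      linarith
    filter_upwards [hd] with r hr
    rw [derivative_sub, derivative_momentPoly, derivative_momentPoly, ← mul_sub, eval_mul,
      eval_C, eval_sub, eval_momentPoly hX hXb, eval_momentPoly hY hYb] at hr
    have := nonneg_of_mul_nonneg_right hr (by positivity)
    linarith

end Moments

/-! ### Smooth test functions -/

lemma hasDerivAt_taylor_sum {g : ℕ → ℝ → ℝ} {N : ℕ}
    (hg : ∀ k ≤ N, ∀ t, HasDerivAt (g k) (-g (k + 1) t) t) (x t : ℝ) :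
    HasDerivAt (fun t => ∑ k ∈ Finset.range (N + 1), g k t * ((t - x) ^ k / k.factorial))
      (-(g (N + 1) t * ((t - x) ^ N / N.factorial))) t := by
  induction N with
  | zero => simpa using hg 0 le_rfl t
  | succ N ih =>
    simp only [Finset.sum_range_succ _ (N + 1)]
    have hp : HasDerivAt (fun t : ℝ => (t - x) ^ (N + 1) / ((N + 1).factorial : ℝ))
        ((t - x) ^ N / N.factorial) t := by
      have h := (((hasDerivAt_id t).sub_const x).pow (N + 1)).div_const ((N + 1).factorial : ℝ)
      refine h.congr_deriv ?_
      have : ((N.factorial : ℕ) : ℝ) ≠ 0 := by positivity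
      have : ((N : ℝ) + 1) ≠ 0 := by positivity
      simp only [Nat.factorial_succ, id, Nat.add_sub_cancel]
      push_cast
      field_simp
    refine ((ih fun k hk => hg k (by omega)).add ((hg (N + 1) le_rfl t).mul hp)).congr_deriv ?_
    ring

lemma taylor_positive_part {g : ℕ → ℝ → ℝ} {N : ℕ} (hN : N ≠ 0)
    (hg : ∀ k ≤ N, ∀ t, HasDerivAt (g k) (-g (k + 1) t) t) (hc : Continuous (g (N + 1)))
    {a x r : ℝ} (hax : a ≤ x) (hxr : x ≤ r) :
    g 0 x = (∑ k ∈ Finset.range (N + 1), g k r / k.factorial * (r - x) ^ k) +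
      ∫ t in Ioc a r, g (N + 1) t / N.factorial * (max (t - x) 0) ^ N := by
  have hF : Continuous fun t => g (N + 1) t * ((t - x) ^ N / N.factorial) := by fun_prop
  have hG : Continuous fun t => g (N + 1) t / N.factorial * (max (t - x) 0) ^ N := by fun_prop
  have ftc := intervalIntegral.integral_eq_sub_of_hasDerivAt
    (fun t _ => hasDerivAt_taylor_sum hg x t) (hF.neg.intervalIntegrable x r)
  rw [Finset.sum_range_succ' (fun k => g k x * ((x - x) ^ k / k.factorial))] at ftc
  simp only [sub_self, ne_eq, Nat.add_eq_zero_iff, one_ne_zero, and_false, not_false_eq_true,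
    zero_pow, zero_div, mul_zero, Finset.sum_const_zero, zero_add, pow_zero, Nat.factorial_zero,
    Nat.cast_one, div_one, mul_one, intervalIntegral.integral_neg] at ftc
  have hsplit := intervalIntegral.integral_add_adjacent_intervals
    (hG.intervalIntegrable (μ := volume) a x) (hG.intervalIntegrable x r)
  have hz : ∫ t in a..x, g (N + 1) t / N.factorial * (max (t - x) 0) ^ N = 0 := by
    refine (intervalIntegral.integral_congr (g := fun _ => (0 : ℝ)) fun t ht => ?_).trans
      (by simp)
    rw [uIcc_of_le hax] at ht
    simp [max_eq_right (sub_nonpos.2 ht.2), hN]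
  have he : ∫ t in x..r, g (N + 1) t / N.factorial * (max (t - x) 0) ^ N =
      ∫ t in x..r, g (N + 1) t * ((t - x) ^ N / N.factorial) := by
    refine intervalIntegral.integral_congr fun t ht => ?_
    rw [uIcc_of_le hxr] at ht
    simp only [max_eq_left (sub_nonneg.2 ht.1)]
    ring
  have hs : ∑ k ∈ Finset.range (N + 1), g k r / k.factorial * (r - x) ^ k =
      ∑ k ∈ Finset.range (N + 1), g k r * ((r - x) ^ k / k.factorial) :=
    Finset.sum_congr rfl fun k _ => by ring
  rw [← intervalIntegral.integral_of_le (hax.trans hxr), ← hsplit, hz, he, hs]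
  linarith

lemma integrable_prod_positive_part {Ω : Type*} [MeasurableSpace Ω] {μ : Measure Ω}
    [IsFiniteMeasure μ] {Z : Ω → ℝ} (hZ : Measurable Z) (hZb : ∃ C, ∀ ω, |Z ω| ≤ C)
    {f : ℝ → ℝ} (hf : Continuous f) (N : ℕ) (a r : ℝ) :
    Integrable (Function.uncurry fun ω t => f t * (max (t - Z ω) 0) ^ N)
      (μ.prod (volume.restrict (Ioc a r))) := by
  obtain ⟨C, hC⟩ := hZb
  have hF : Continuous fun p : ℝ × ℝ => f p.2 * (max (p.2 - p.1) 0) ^ N := by fun_prop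
  obtain ⟨B, hB⟩ := ((isCompact_Icc (a := -C) (b := C)).prod
    (isCompact_Icc (a := a) (b := r))).exists_bound_of_continuousOn hF.continuousOn
  refine Integrable.of_bound (C := B) ?_ ?_
  · exact (hF.measurable.comp
      ((hZ.comp measurable_fst).prodMk measurable_snd)).aestronglyMeasurable
  · have ht : ∀ᵐ p : Ω × ℝ ∂(μ.prod (volume.restrict (Ioc a r))), p.2 ∈ Ioc a r :=
      Measure.quasiMeasurePreserving_snd.ae (ae_restrict_mem measurableSet_Ioc)
    filter_upwards [ht] with p hp
    exact hB (Z p.1, p.2) ⟨abs_le.1 (hC p.1), Ioc_subset_Icc_self hp⟩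

lemma integral_taylor_positive_part {Ω : Type*} [MeasurableSpace Ω] {μ : Measure Ω}
    [IsFiniteMeasure μ] {Z : Ω → ℝ} (hZ : Measurable Z) {C r : ℝ} (hC : ∀ ω, |Z ω| ≤ C)
    (hr : C ≤ r) {g : ℕ → ℝ → ℝ} {N : ℕ} (hN : N ≠ 0)
    (hg : ∀ k ≤ N, ∀ t, HasDerivAt (g k) (-g (k + 1) t) t) (hc : Continuous (g (N + 1))) :
    ∫ ω, g 0 (Z ω) ∂μ =
      (∑ k ∈ Finset.range (N + 1), g k r / k.factorial * ∫ ω, (r - Z ω) ^ k ∂μ) +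
      ∫ t in Ioc (-C) r, g (N + 1) t / N.factorial * ∫ ω, (max (t - Z ω) 0) ^ N ∂μ := by
  have hint := integrable_prod_positive_part (μ := μ) hZ ⟨C, hC⟩
    (hc.div_const (N.factorial : ℝ)) N (-C) r
  have hpt : ∀ ω, g 0 (Z ω) = (∑ k ∈ Finset.range (N + 1), g k r / k.factorial * (r - Z ω) ^ k) +
      ∫ t in Ioc (-C) r, g (N + 1) t / N.factorial * (max (t - Z ω) 0) ^ N := fun ω =>
    taylor_positive_part hN hg hc (abs_le.1 (hC ω)).1 ((abs_le.1 (hC ω)).2.trans hr)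
  have hk : ∀ k ∈ Finset.range (N + 1),
      Integrable (fun ω => g k r / k.factorial * (r - Z ω) ^ k) μ := fun k _ =>
    integrable_comp_of_bounded hZ ⟨C, hC⟩ (f := fun z => g k r / k.factorial * (r - z) ^ k)
      (by fun_prop)
  simp only [hpt]
  have hR : Integrable (fun ω =>
      ∫ t in Ioc (-C) r, g (N + 1) t / N.factorial * (max (t - Z ω) 0) ^ N) μ :=
    hint.integral_prod_left
  rw [integral_add (integrable_finsetSum _ hk) hR, integral_finsetSum _ hk,
    integral_integral_swap hint]
  simp only [integral_const_mul]

lemma integral_le_of_SD_of_alternating {Ω : Type*} [MeasurableSpace Ω] {μ : Measure Ω}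
    [IsFiniteMeasure μ] {X Y : Ω → ℝ} (hX : Measurable X) (hY : Measurable Y)
    (hXb : ∃ C, ∀ ω, |X ω| ≤ C) (hYb : ∃ C, ∀ ω, |Y ω| ≤ C) {N : ℕ} (hN : N ≠ 0)
    (h : SD μ X Y (N + 1)) {g : ℕ → ℝ → ℝ}
    (hg : ∀ k ≤ N, ∀ t, HasDerivAt (g k) (-g (k + 1) t) t) (hc : Continuous (g (N + 1)))
    (hpos : ∀ k, 1 ≤ k → k ≤ N + 1 → ∀ t, 0 ≤ g k t) :
    ∫ ω, g 0 (X ω) ∂μ ≤ ∫ ω, g 0 (Y ω) ∂μ := by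
  have hSD : ∀ t : ℝ, ∫ ω, (max (t - X ω) 0) ^ N ∂μ ≤ ∫ ω, (max (t - Y ω) 0) ^ N ∂μ := by
    intro t
    simpa [momFn, hN] using h t
  obtain ⟨C, hCX, hCY⟩ : ∃ C, (∀ ω, |X ω| ≤ C) ∧ ∀ ω, |Y ω| ≤ C := by
    obtain ⟨A, hA⟩ := hXb
    obtain ⟨B, hB⟩ := hYb
    exact ⟨max A B, fun ω => (hA ω).trans (le_max_left _ _),
      fun ω => (hB ω).trans (le_max_right _ _)⟩
  have hev : ∀ᶠ r in atTop, ∫ ω, (r - X ω) ^ N ∂μ ≤ ∫ ω, (r - Y ω) ^ N ∂μ := by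
    filter_upwards [eventually_ge_atTop C] with r hr
    have hX' : ∀ ω, max (r - X ω) 0 = r - X ω := fun ω =>
      max_eq_left (by linarith [(abs_le.1 (hCX ω)).2])
    have hY' : ∀ ω, max (r - Y ω) 0 = r - Y ω := fun ω =>
      max_eq_left (by linarith [(abs_le.1 (hCY ω)).2])
    simpa only [hX', hY'] using hSD r
  have hall : ∀ᶠ r in atTop, ∀ k ∈ Finset.range (N + 1),
      ∫ ω, (r - X ω) ^ k ∂μ ≤ ∫ ω, (r - Y ω) ^ k ∂μ :=
    (Filter.eventually_all_finset _).2 fun k hk =>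
      eventually_moment_le hX hY hXb hYb hev (Nat.lt_succ_iff.1 (Finset.mem_range.1 hk))
  obtain ⟨r, hr, hCr⟩ := (hall.and (eventually_ge_atTop C)).exists
  rw [integral_taylor_positive_part hX hCX hCr hN hg hc,
    integral_taylor_positive_part hY hCY hCr hN hg hc]
  have hi : ∀ {Z : Ω → ℝ}, Measurable Z → (∀ ω, |Z ω| ≤ C) → IntegrableOn
      (fun t => g (N + 1) t / N.factorial * ∫ ω, (max (t - Z ω) 0) ^ N ∂μ) (Ioc (-C) r) := by
    intro Z hZ hCZ
    have := (integrable_prod_positive_part (μ := μ) hZ ⟨C, hCZ⟩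
      (hc.div_const (N.factorial : ℝ)) N (-C) r).integral_prod_right
    simpa only [IntegrableOn, Function.uncurry, integral_const_mul] using this
  refine add_le_add (Finset.sum_le_sum fun k hk => ?_)
    (integral_mono (hi hX hCX) (hi hY hCY) fun t => ?_)
  · rcases Nat.eq_zero_or_pos k with rfl | hk0
    · simp
    · have := hpos k hk0 (Finset.mem_range.1 hk).le r
      exact mul_le_mul_of_nonneg_left (hr k hk) (by positivity)
  · have := hpos (N + 1) (by omega) le_rfl t
    exact mul_le_mul_of_nonneg_left (hSD t) (by positivity)

/-! ### Smoothing by moving integrals -/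

/-- The moving integral of `f` over a window of length `h`. -/
noncomputable def movingIntegral (h : ℝ) (f : ℝ → ℝ) (x : ℝ) : ℝ := ∫ t in x..(x + h), f t

lemma hasDerivAt_movingIntegral {f : ℝ → ℝ} (hf : Continuous f) (h x : ℝ) :
    HasDerivAt (movingIntegral h f) (f (x + h) - f x) x := by
  have heq : movingIntegral h f = fun x =>
      (∫ t in (0 : ℝ)..(x + h), f t) - ∫ t in (0 : ℝ)..x, f t := by
    funext y
    exact (intervalIntegral.integral_interval_sub_left (hf.intervalIntegrable _ _)
      (hf.intervalIntegrable _ _)).symm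
  rw [heq]
  exact ((hf.integral_hasStrictDerivAt 0 (x + h)).hasDerivAt.comp_add_const x h).sub
    (hf.integral_hasStrictDerivAt 0 x).hasDerivAt

lemma continuous_movingIntegral {f : ℝ → ℝ} (hf : Continuous f) (h : ℝ) :
    Continuous (movingIntegral h f) :=
  continuous_iff_continuousAt.2 fun x => (hasDerivAt_movingIntegral hf h x).continuousAt

lemma hasDerivAt_movingIntegral_of_hasDerivAt {f f' : ℝ → ℝ} (hf : ∀ x, HasDerivAt f (f' x) x)
    (hf' : Continuous f') (h x : ℝ) :
    HasDerivAt (movingIntegral h f) (movingIntegral h f' x) x := by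
  have hc : Continuous f := continuous_iff_continuousAt.2 fun x => (hf x).continuousAt
  refine (hasDerivAt_movingIntegral hc h x).congr_deriv ?_
  exact (intervalIntegral.integral_eq_sub_of_hasDerivAt (fun t _ => hf t)
    (hf'.intervalIntegrable _ _)).symm

lemma movingIntegral_neg (h : ℝ) (f : ℝ → ℝ) :
    movingIntegral h (fun t => -f t) = fun x => -movingIntegral h f x := by
  funext x
  exact intervalIntegral.integral_neg

lemma movingIntegral_nonneg {h : ℝ} (hh : 0 ≤ h) {f : ℝ → ℝ} (hf : ∀ x, 0 ≤ f x) (x : ℝ) :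
    0 ≤ movingIntegral h f x :=
  intervalIntegral.integral_nonneg (by linarith) fun t _ => hf t

lemma movingIntegral_le {h : ℝ} (hh : 0 ≤ h) {f : ℝ → ℝ} (hf : Antitone f) (x : ℝ) :
    movingIntegral h f x ≤ h * f x := by
  have := intervalIntegral.integral_mono_on (μ := volume) (a := x) (b := x + h) (by linarith)
    hf.intervalIntegrable (intervalIntegrable_const (c := f x)) fun t ht => hf ht.1
  simpa [movingIntegral] using this

lemma le_movingIntegral {h : ℝ} (hh : 0 ≤ h) {f : ℝ → ℝ} (hf : Antitone f) (x : ℝ) :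
    h * f (x + h) ≤ movingIntegral h f x := by
  have := intervalIntegral.integral_mono_on (μ := volume) (a := x) (b := x + h) (by linarith)
    (intervalIntegrable_const (c := f (x + h))) hf.intervalIntegrable fun t ht => hf ht.2
  simpa [movingIntegral] using this

lemma antitone_movingIntegral {h : ℝ} (hh : 0 ≤ h) {f : ℝ → ℝ} (hc : Continuous f)
    (hf : Antitone f) : Antitone (movingIntegral h f) :=
  antitone_of_hasDerivAt_nonpos (fun x => hasDerivAt_movingIntegral hc h x)
    fun x => sub_nonpos.2 (hf (by linarith))

lemma second_difference_nonneg {w : ℝ → ℝ} (hw : ConvexOn ℝ univ w) (h x : ℝ) :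
    0 ≤ (w (x + h + h) - w (x + h)) - (w (x + h) - w x) := by
  have := hw.2 (mem_univ x) (mem_univ (x + h + h)) (show (0 : ℝ) ≤ 1 / 2 by norm_num)
    (show (0 : ℝ) ≤ 1 / 2 by norm_num) (by norm_num)
  have he : (1 / 2 : ℝ) • x + (1 / 2 : ℝ) • (x + h + h) = x + h := by
    simp only [smul_eq_mul]
    ring
  rw [he] at this
  simp only [smul_eq_mul] at this
  linarith

/-- The smoothing of a sequence `w 0, …, w m` of alternating derivatives, extended by two
further terms. -/
noncomputable def smoothedChain (h : ℝ) (w : ℕ → ℝ → ℝ) (m k : ℕ) : ℝ → ℝ :=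
  if k ≤ m then movingIntegral h (movingIntegral h (w k))
  else if k = m + 1 then movingIntegral h fun x => -(w m (x + h) - w m x)
  else fun x => (w m (x + h + h) - w m (x + h)) - (w m (x + h) - w m x)

lemma hasDerivAt_smoothedChain {w : ℕ → ℝ → ℝ} {m : ℕ}
    (hw : ∀ k < m, ∀ t, HasDerivAt (w k) (-w (k + 1) t) t) (hc : ∀ k ≤ m, Continuous (w k))
    (h : ℝ) {k : ℕ} (hk : k ≤ m + 1) (t : ℝ) :
    HasDerivAt (smoothedChain h w m k) (-smoothedChain h w m (k + 1) t) t := by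
  have hcm := hc m le_rfl
  rcases lt_trichotomy k m with hlt | rfl | hgt
  · have hcs := hc (k + 1) hlt
    simp only [smoothedChain, if_pos hlt.le, if_pos (Nat.succ_le_of_lt hlt)]
    have h1 : ∀ x, HasDerivAt (movingIntegral h (w k)) (-movingIntegral h (w (k + 1)) x) x := by
      intro x
      have := hasDerivAt_movingIntegral_of_hasDerivAt (hw k hlt) hcs.neg h x
      rwa [movingIntegral_neg] at this
    have := hasDerivAt_movingIntegral_of_hasDerivAt h1 (continuous_movingIntegral hcs h).neg h t
    rwa [movingIntegral_neg] at this
  · simp only [smoothedChain, le_refl, if_true, if_neg (Nat.not_succ_le_self k)]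
    refine (hasDerivAt_movingIntegral_of_hasDerivAt (fun x => hasDerivAt_movingIntegral hcm h x)
      (by fun_prop) h t).congr_deriv ?_
    rw [movingIntegral_neg, neg_neg]
  · obtain rfl : k = m + 1 := by omega
    simp only [smoothedChain, if_neg (Nat.not_succ_le_self m), if_true,
      if_neg (show ¬ m + 1 + 1 ≤ m by omega), if_neg (show m + 1 + 1 ≠ m + 1 by omega)]
    refine (hasDerivAt_movingIntegral (f := fun x => -(w m (x + h) - w m x)) (by fun_prop)
      h t).congr_deriv ?_
    ring

lemma smoothedChain_nonneg {w : ℕ → ℝ → ℝ} {m : ℕ} (hpos : ∀ k, 1 ≤ k → k ≤ m → ∀ t, 0 ≤ w k t)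
    (hanti : Antitone (w m)) (hconv : ConvexOn ℝ univ (w m)) {h : ℝ} (hh : 0 ≤ h) {k : ℕ}
    (hk : 1 ≤ k) (t : ℝ) : 0 ≤ smoothedChain h w m k t := by
  unfold smoothedChain
  split_ifs with h1 h2
  · exact movingIntegral_nonneg hh (movingIntegral_nonneg hh (hpos k hk h1)) t
  · exact movingIntegral_nonneg hh
      (fun x => neg_nonneg.2 (sub_nonpos.2 (hanti (by linarith)))) t
  · exact second_difference_nonneg hconv h t

lemma integral_le_of_SD_of_convex {Ω : Type*} [MeasurableSpace Ω] {μ : Measure Ω}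
    [IsFiniteMeasure μ] {X Y : Ω → ℝ} (hX : Measurable X) (hY : Measurable Y)
    (hXb : ∃ C, ∀ ω, |X ω| ≤ C) (hYb : ∃ C, ∀ ω, |Y ω| ≤ C) {m : ℕ} (hm : 1 ≤ m)
    (hSD : SD μ X Y (m + 2)) {w : ℕ → ℝ → ℝ}
    (hw : ∀ k < m, ∀ t, HasDerivAt (w k) (-w (k + 1) t) t)
    (hpos : ∀ k, 1 ≤ k → k ≤ m → ∀ t, 0 ≤ w k t)
    (hanti : Antitone (w m)) (hconv : ConvexOn ℝ univ (w m)) :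
    ∫ ω, w 0 (X ω) ∂μ ≤ ∫ ω, w 0 (Y ω) ∂μ := by
  have hc : ∀ k ≤ m, Continuous (w k) := by
    intro k hk
    rcases hk.lt_or_eq with hlt | rfl
    · exact continuous_iff_continuousAt.2 fun x => (hw k hlt x).continuousAt
    · exact continuousOn_univ.1 (hconv.continuousOn isOpen_univ)
  have hc0 := hc 0 (Nat.zero_le m)
  have hcm := hc m le_rfl
  have hanti0 : Antitone (w 0) := antitone_of_hasDerivAt_nonpos (hw 0 (by omega))
    fun x => neg_nonpos.2 (hpos 1 le_rfl hm x)
  have hshift : ∀ h : ℝ, 0 < h → ∫ ω, w 0 (X ω + h + h) ∂μ ≤ ∫ ω, w 0 (Y ω) ∂μ := by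
    intro h hh
    have hc1 := continuous_movingIntegral hc0 h
    have hc2 := continuous_movingIntegral hc1 h
    have ha1 := antitone_movingIntegral hh.le hc0 hanti0
    have hcore := integral_le_of_SD_of_alternating hX hY hXb hYb (Nat.succ_ne_zero m) hSD
      (g := smoothedChain h w m) (fun k hk t => hasDerivAt_smoothedChain hw hc h hk t)
      (by
        simp only [smoothedChain, if_neg (show ¬ m + 1 + 1 ≤ m by omega),
          if_neg (show m + 1 + 1 ≠ m + 1 by omega)]
        fun_prop)
      (fun k hk _ t => smoothedChain_nonneg hpos hanti hconv hh.le hk t)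
    simp only [smoothedChain, Nat.zero_le, if_true] at hcore
    have hlow : ∫ ω, h * (h * w 0 (X ω + h + h)) ∂μ ≤
        ∫ ω, movingIntegral h (movingIntegral h (w 0)) (X ω) ∂μ := by
      refine integral_mono
        (integrable_comp_of_bounded hX hXb (f := fun z => h * (h * w 0 (z + h + h)))
          (by fun_prop))
        (integrable_comp_of_bounded hX hXb hc2) fun ω => ?_
      exact (mul_le_mul_of_nonneg_left (le_movingIntegral hh.le hanti0 _) hh.le).trans
        (le_movingIntegral hh.le ha1 _)
    have hupp : ∫ ω, movingIntegral h (movingIntegral h (w 0)) (Y ω) ∂μ ≤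
        ∫ ω, h * (h * w 0 (Y ω)) ∂μ := by
      refine integral_mono (integrable_comp_of_bounded hY hYb hc2)
        (integrable_comp_of_bounded hY hYb (f := fun z => h * (h * w 0 z)) (by fun_prop))
        fun ω => ?_
      exact (movingIntegral_le hh.le ha1 _).trans
        (mul_le_mul_of_nonneg_left (movingIntegral_le hh.le hanti0 _) hh.le)
    have := hlow.trans (hcore.trans hupp)
    simp only [integral_const_mul] at this
    exact le_of_mul_le_mul_left (le_of_mul_le_mul_left this hh) hh
  have hlim : Tendsto (fun h : ℝ => ∫ ω, w 0 (X ω + h + h) ∂μ) (nhdsWithin 0 (Ioi 0))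
      (nhds (∫ ω, w 0 (X ω) ∂μ)) := by
    refine tendsto_integral_filter_of_dominated_convergence
      (fun ω => |w 0 (X ω)| + |w 0 (X ω + 1 + 1)|) ?_ ?_ ?_ ?_
    · exact Eventually.of_forall fun h => (hc0.measurable.comp
        ((hX.add_const h).add_const h)).aestronglyMeasurable
    · filter_upwards [Ioo_mem_nhdsGT (show (0 : ℝ) < 1 by norm_num)] with h hh
      refine Eventually.of_forall fun ω => ?_
      have h1 : w 0 (X ω + h + h) ≤ w 0 (X ω) := hanti0 (by linarith [hh.1])
      have h2 : w 0 (X ω + 1 + 1) ≤ w 0 (X ω + h + h) := hanti0 (by linarith [hh.2])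
      rw [Real.norm_eq_abs, abs_le]
      constructor
      · linarith [neg_abs_le (w 0 (X ω + 1 + 1)), abs_nonneg (w 0 (X ω))]
      · linarith [le_abs_self (w 0 (X ω)), abs_nonneg (w 0 (X ω + 1 + 1))]
    · exact integrable_comp_of_bounded hX hXb (f := fun z => |w 0 z| + |w 0 (z + 1 + 1)|)
        (by fun_prop)
    · refine Eventually.of_forall fun ω => ?_
      have hcont : Continuous fun h : ℝ => w 0 (X ω + h + h) := by fun_prop
      have := hcont.tendsto 0
      simp only [add_zero] at this
      exact this.mono_left nhdsWithin_le_nhds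
  refine le_of_tendsto hlim ?_
  filter_upwards [self_mem_nhdsWithin] with h hh
  exact hshift h hh

/-! ### Powers of the positive part -/

lemma hasDerivAt_positive_part_pow (η x : ℝ) {j : ℕ} (hj : 1 ≤ j) :
    HasDerivAt (fun x : ℝ => (max (η - x) 0) ^ (j + 1))
      (-((j : ℝ) + 1) * (max (η - x) 0) ^ j) x := by
  have hne : ∀ y, y ≠ η → HasDerivAt (fun x : ℝ => (max (η - x) 0) ^ (j + 1))
      (-((j : ℝ) + 1) * (max (η - y) 0) ^ j) y := by
    intro y hy
    rcases hy.lt_or_gt with hlt | hgt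
    · have h := ((hasDerivAt_id y).const_sub η).pow (j + 1)
      refine (h.congr_of_eventuallyEq ?_).congr_deriv ?_
      · filter_upwards [Iio_mem_nhds hlt] with z hz
        simp [max_eq_left (sub_nonneg.2 (mem_Iio.1 hz).le)]
      · simp only [max_eq_left (sub_nonneg.2 hlt.le), id, Nat.add_sub_cancel]
        push_cast
        ring
    · refine ((hasDerivAt_const y (0 : ℝ)).congr_of_eventuallyEq ?_).congr_deriv ?_
      · filter_upwards [Ioi_mem_nhds hgt] with z hz
        simp [max_eq_right (sub_nonpos.2 (mem_Ioi.1 hz).le)]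
      · simp [max_eq_right (sub_nonpos.2 hgt.le), show j ≠ 0 by omega]
  rcases eq_or_ne x η with rfl | hx
  · exact hasDerivAt_of_hasDerivAt_of_ne' hne (by fun_prop)
      (g := fun y => -((j : ℝ) + 1) * (max (x - y) 0) ^ j) (by fun_prop) x
  · exact hne x hx

lemma iteratedDeriv_neg_positive_part_pow (η : ℝ) {N k : ℕ} (hk : k + 1 ≤ N) :
    iteratedDeriv k (fun x : ℝ => -(max (η - x) 0) ^ N) =
      fun x => (-1) ^ (k + 1) * (N.descFactorial k : ℝ) * (max (η - x) 0) ^ (N - k) := by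
  induction k with
  | zero => simp
  | succ k ih =>
    rw [iteratedDeriv_succ, ih (by omega)]
    funext x
    obtain ⟨j, rfl⟩ : ∃ j, N = k + j + 1 := ⟨N - k - 1, by omega⟩
    have hd := (hasDerivAt_positive_part_pow η x (j := j) (by omega)).const_mul
      ((-1) ^ (k + 1) * ((k + j + 1).descFactorial k : ℝ))
    rw [show k + j + 1 - k = j + 1 by omega, hd.deriv, Nat.descFactorial_succ,
      show k + j + 1 - k = j + 1 by omega, show k + j + 1 - (k + 1) = j by omega]
    push_cast
    ring

lemma UBar_neg_momFn {n : ℕ} (hn : 3 ≤ n) (η : ℝ) : UBar n (fun x => -momFn n η x) := by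
  obtain ⟨m, rfl⟩ : ∃ m, n = m + 2 := ⟨n - 2, by omega⟩
  have hfun : (fun x => -momFn (m + 2) η x) = fun x => -(max (η - x) 0) ^ (m + 1) := by
    funext x
    simp [momFn]
  have hlast : (fun x => (-1 : ℝ) ^ m * iteratedDeriv m (fun x => -(max (η - x) 0) ^ (m + 1)) x) =
      fun x => -(((m + 1).descFactorial m : ℝ) * max (η - x) 0) := by
    rw [iteratedDeriv_neg_positive_part_pow η le_rfl]
    funext x
    have h1 : (-1 : ℝ) ^ m * (-1) ^ m = 1 := by rw [← mul_pow]; simp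
    simp only [Nat.add_sub_cancel_left, pow_succ]
    linear_combination (-(((m + 1).descFactorial m : ℝ) * max (η - x) 0)) * h1
  rw [UBar, hfun, Nat.add_sub_cancel, hlast]
  refine ⟨fun k hk => ?_, fun k hk x => ?_, fun x y hxy => ?_, ?_⟩
  · rw [iteratedDeriv_neg_positive_part_pow η (by omega)]
    obtain ⟨j, hj⟩ : ∃ j, m + 1 - k = j + 1 := ⟨m - k, by omega⟩
    rw [hj]
    exact fun x => ((hasDerivAt_positive_part_pow η x (by omega)).const_mul _).differentiableAt
  · obtain ⟨hk1, hkm⟩ := Finset.mem_Icc.1 hk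
    rw [iteratedDeriv_neg_positive_part_pow η (by omega)]
    obtain ⟨j, rfl⟩ : ∃ j, k = j + 1 := ⟨k - 1, by omega⟩
    have h1 : (-1 : ℝ) ^ j * (-1) ^ (j + 1 + 1) = 1 := by
      rw [pow_succ, pow_succ, mul_assoc, mul_neg_one, neg_neg, mul_one, ← mul_pow]
      simp
    rw [Nat.add_sub_cancel, ← mul_assoc, ← mul_assoc, h1]
    positivity
  · have : max (η - y) 0 ≤ max (η - x) 0 := max_le_max_right 0 (by linarith)
    exact neg_le_neg (mul_le_mul_of_nonneg_left this (by positivity))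
  · have hlin : ConvexOn ℝ univ fun x : ℝ => η - x :=
      (convexOn_const η convex_univ).sub (concaveOn_id convex_univ)
    have hcx := (hlin.sup (convexOn_const 0 convex_univ)).smul
      (show (0 : ℝ) ≤ ((m + 1).descFactorial m : ℝ) by positivity)
    exact hcx.neg

theorem stmt_3 {Ω : Type*} [MeasurableSpace Ω] (μ : Measure Ω) [IsProbabilityMeasure μ]
    (n : ℕ) (hn : 3 ≤ n)
    (X Y : Ω → ℝ) (hX : Measurable X) (hY : Measurable Y)
    (hXb : ∃ C, ∀ ω, |X ω| ≤ C) (hYb : ∃ C, ∀ ω, |Y ω| ≤ C) :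
    SD μ X Y n ↔
      ∀ u : ℝ → ℝ, UBar n u → (∫ ω, u (Y ω) ∂μ) ≤ ∫ ω, u (X ω) ∂μ := by
  constructor
  · rintro hSD u ⟨hdiff, hsign, hmono, hconc⟩
    obtain ⟨m, rfl⟩ : ∃ m, n = m + 2 := ⟨n - 2, by omega⟩
    rw [Nat.add_sub_cancel] at hdiff hsign hmono hconc
    have key := integral_le_of_SD_of_convex hX hY hXb hYb (by omega : 1 ≤ m) hSD
      (w := fun k x => -((-1) ^ k * iteratedDeriv k u x)) ?_ ?_ ?_ ?_
    · simp only [pow_zero, one_mul, iteratedDeriv_zero, integral_neg] at key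
      linarith
    · intro k hk t
      have hd := ((hdiff k hk t).hasDerivAt.const_mul ((-1 : ℝ) ^ k)).neg
      refine hd.congr_deriv ?_
      rw [iteratedDeriv_succ]
      ring
    · intro k hk1 hkm t
      obtain ⟨j, rfl⟩ : ∃ j, k = j + 1 := ⟨k - 1, by omega⟩
      have := hsign (j + 1) (Finset.mem_Icc.2 ⟨hk1, hkm⟩) t
      rw [Nat.add_sub_cancel] at this
      simpa [pow_succ] using this
    · exact hmono.neg
    · exact hconc.neg
  · intro h η
    have := h _ (UBar_neg_momFn hn η)
    simp only [integral_neg] at this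
    linarith
end

section
/- Let a < b be real numbers. For all X, Y ∈ 𝒳_{[a,b]}, if X dominates Y in third-order stochastic dominance on ℝ (X ≥₃ Y), then X dominates Y in third-order stochastic dominance on [a,b] (X ≥₃^{[a,b]} Y). -/
open MeasureTheory Filter Set

/-- Above the range of `Z`, the third-order integrated moment is a quadratic polynomial in `s`. -/
lemma integral_momFn_three_add {Ω : Type*} [MeasurableSpace Ω] (μ : Measure Ω)
    [IsProbabilityMeasure μ] {a b : ℝ} {Z : Ω → ℝ} (hZ : Measurable Z)
    (hZab : ∀ ω, Z ω ∈ Set.Icc a b) {s : ℝ} (hs : 0 ≤ s) :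
    ∫ ω, momFn 3 (b + s) (Z ω) ∂μ =
      ∫ ω, (b - Z ω) ^ 2 ∂μ + 2 * s * ∫ ω, (b - Z ω) ∂μ + s ^ 2 := by
  have hbound : ∀ ω, ‖b - Z ω‖ ≤ b - a := fun ω => by
    rw [Real.norm_eq_abs, abs_le]
    constructor <;> linarith [(hZab ω).1, (hZab ω).2]
  have hint : Integrable (fun ω => b - Z ω) μ :=
    .of_bound (by fun_prop) (b - a) (.of_forall hbound)
  have hint_sq : Integrable (fun ω => (b - Z ω) ^ 2) μ :=
    .of_bound (by fun_prop) ((b - a) ^ 2) (.of_forall fun ω => by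
      rw [norm_pow]
      exact pow_le_pow_left₀ (norm_nonneg _) (hbound ω) 2)
  have hexpand : ∀ ω, momFn 3 (b + s) (Z ω) =
      (b - Z ω) ^ 2 + 2 * s * (b - Z ω) + s ^ 2 := fun ω => by
    have hnonneg : 0 ≤ b + s - Z ω := by linarith [(hZab ω).2]
    simp only [momFn, max_eq_left hnonneg]
    norm_num
    ring
  simp_rw [hexpand]
  rw [integral_add (by fun_prop) (integrable_const _),
    integral_add hint_sq (hint.const_mul _), integral_const_mul]
  simp

/-- The leading coefficients of affine functions ordered on `[0, ∞)` are ordered. -/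
lemma slope_le_of_forall_nonneg {p q u v : ℝ}
    (h : ∀ s : ℝ, 0 ≤ s → p + 2 * s * u ≤ q + 2 * s * v) : u ≤ v := by
  by_contra! hlt
  have hpos : 0 < u - v := sub_pos.mpr hlt
  have hs := h ((|q - p| + 1) / (u - v)) (by positivity)
  have hmul : (|q - p| + 1) / (u - v) * (u - v) = |q - p| + 1 := div_mul_cancel₀ _ hpos.ne'
  nlinarith [le_abs_self (q - p), abs_nonneg (q - p)]

theorem stmt_4 {Ω : Type*} [MeasurableSpace Ω] (μ : Measure Ω) [IsProbabilityMeasure μ]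
    (a b : ℝ) (hab : a < b)
    (X Y : Ω → ℝ) (hX : Measurable X) (hY : Measurable Y)
    (hXab : ∀ ω, X ω ∈ Set.Icc a b) (hYab : ∀ ω, Y ω ∈ Set.Icc a b)
    (h : SD μ X Y 3) : SDI μ X Y 3 a b := by
  have hquad : ∀ s : ℝ, 0 ≤ s →
      ∫ ω, (b - X ω) ^ 2 ∂μ + 2 * s * ∫ ω, (b - X ω) ∂μ ≤
        ∫ ω, (b - Y ω) ^ 2 ∂μ + 2 * s * ∫ ω, (b - Y ω) ∂μ := fun s hs => by
    have hsd := h (b + s)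
    rw [integral_momFn_three_add μ hX hXab hs, integral_momFn_three_add μ hY hYab hs] at hsd
    linarith
  refine ⟨fun η _ => h η, fun k hk => ?_⟩
  obtain ⟨hk1, hk3⟩ := Finset.mem_Icc.mp hk
  interval_cases k
  · simp
  · simpa only [Nat.add_one_sub_one, pow_one] using slope_le_of_forall_nonneg hquad
  · simpa using hquad 0 le_rfl
end

section
/- Let c < d be real numbers and n ≥ 4 an integer. There exist random variables X, Y taking values in [c,d] such that X dominates Y in nth-order stochastic dominance on ℝ (X ≥ₙ Y) but X does not dominate Y in nth-order stochastic dominance on [c,d] (X ≥ₙ^{[c,d]} Y fails). -/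
open MeasureTheory Filter Set

/-- The moment comparison between `{0, 2s}` (weights `1/2, 1/2`) and `{4s, s}`
(weights `1/16, 15/16`) translated by `t ≥ 0`. -/
lemma two_point_pow_le {s : ℝ} (hs : 0 ≤ s) (m : ℕ) :
    ∀ t : ℝ, 0 ≤ t →
      8 * (t + 2 * s) ^ (m + 3) + 8 * t ^ (m + 3) ≤
        (t + 4 * s) ^ (m + 3) + 15 * (t + s) ^ (m + 3) := by
  induction m with
  | zero =>
    intro t _
    have h : 0 ≤ s * (9 * t ^ 2 - 3 * s * t + 15 * s ^ 2) :=
      mul_nonneg hs (by nlinarith [sq_nonneg (t - s), sq_nonneg (t + s), sq_nonneg t])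
    norm_num
    nlinarith
  | succ m ih =>
    let g : ℝ → ℝ := fun t => (t + 4 * s) ^ (m + 4) + 15 * (t + s) ^ (m + 4)
      - (8 * (t + 2 * s) ^ (m + 4) + 8 * t ^ (m + 4))
    have hpow (a t : ℝ) :
        HasDerivAt (fun t : ℝ => (t + a) ^ (m + 4)) ((m + 4 : ℝ) * (t + a) ^ (m + 3)) t := by
      simpa using ((hasDerivAt_id t).add_const a).fun_pow (m + 4)
    have hg (t : ℝ) : HasDerivAt g ((m + 4 : ℝ) * ((t + 4 * s) ^ (m + 3) + 15 * (t + s) ^ (m + 3)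
        - (8 * (t + 2 * s) ^ (m + 3) + 8 * t ^ (m + 3)))) t := by
      have h0 := hpow 0 t
      simp only [add_zero] at h0
      exact (((hpow (4 * s) t).add ((hpow s t).const_mul 15)).sub
        (((hpow (2 * s) t).const_mul 8).add (h0.const_mul 8))).congr_deriv (by ring)
    have hmono : MonotoneOn g (Ici 0) := by
      refine monotoneOn_of_deriv_nonneg (convex_Ici 0)
        (fun t _ => (hg t).continuousAt.continuousWithinAt)
        (fun t _ => (hg t).differentiableAt.differentiableWithinAt) fun t ht => ?_
      rw [(hg t).deriv]
      rw [interior_Ici] at ht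
      exact mul_nonneg (by positivity) (sub_nonneg.2 (ih t (le_of_lt ht)))
    intro t ht
    have hgt : g 0 ≤ g t := hmono self_mem_Ici ht ht
    have hg0 : 0 ≤ g 0 := by
      have h2 : (8 : ℝ) ≤ 2 ^ (m + 4) := by
        have : (1 : ℝ) ≤ 2 ^ m := one_le_pow₀ (by norm_num)
        rw [pow_add]; linarith
      have h4 : (4 * s) ^ (m + 4) = 2 ^ (m + 4) * (2 * s) ^ (m + 4) := by
        rw [← mul_pow]; ring
      have hle := mul_le_mul_of_nonneg_right h2 (pow_nonneg (mul_nonneg zero_le_two hs) (m + 4))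
      have hs' : 0 ≤ s ^ (m + 4) := pow_nonneg hs _
      simp only [g, zero_add, h4, ne_eq, Nat.add_eq_zero_iff, OfNat.ofNat_ne_zero, and_false,
        not_false_eq_true, zero_pow]
      linarith
    exact sub_nonneg.1 (hg0.trans hgt)

/-- The same comparison for partial moments, at every `t`. -/
lemma two_point_posPart_pow_le {s : ℝ} (hs : 0 ≤ s) {m : ℕ} (hm : 3 ≤ m) (t : ℝ) :
    8 * max (t + 2 * s) 0 ^ m + 8 * max t 0 ^ m ≤
      max (t + 4 * s) 0 ^ m + 15 * max (t + s) 0 ^ m := by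
  obtain ⟨m, rfl⟩ := Nat.exists_eq_add_of_le' hm
  rcases le_total 0 t with ht | ht
  · rw [max_eq_left ht, max_eq_left (by positivity), max_eq_left (by positivity),
      max_eq_left (by positivity)]
    exact two_point_pow_le hs m t ht
  · have h2 : (8 : ℝ) ≤ 2 ^ (m + 3) := by
      have : (1 : ℝ) ≤ 2 ^ m := one_le_pow₀ (by norm_num)
      rw [pow_add]; linarith
    have hdouble : 2 * max (t + 2 * s) 0 ≤ max (t + 4 * s) 0 := by
      rcases le_total (t + 2 * s) 0 with h | h
      · simp [max_eq_right h]
      · rw [max_eq_left h]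
        exact le_max_of_le_left (by linarith)
    have hpow : (2 * max (t + 2 * s) 0) ^ (m + 3) ≤ max (t + 4 * s) 0 ^ (m + 3) :=
      pow_le_pow_left₀ (by positivity) hdouble _
    rw [mul_pow] at hpow
    have hle := mul_le_mul_of_nonneg_right h2
      (show 0 ≤ max (t + 2 * s) 0 ^ (m + 3) by positivity)
    have hV : 0 ≤ max (t + s) 0 ^ (m + 3) := by positivity
    rw [max_eq_right ht, zero_pow (by omega)]
    linarith

lemma integral_uniform_fin {N : ℕ} [NeZero N] (f : Fin N → ℝ) :
    ∫ i, f i ∂(PMF.uniformOfFintype (Fin N)).toMeasure = (N : ℝ)⁻¹ * ∑ i, f i := by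
  simp [PMF.integral_eq_sum, Finset.mul_sum]

theorem stmt_5 (c d : ℝ) (hcd : c < d) (n : ℕ) (hn : 4 ≤ n) :
    ∃ (Ω : Type) (_ : MeasurableSpace Ω) (μ : Measure Ω) (_ : IsProbabilityMeasure μ)
      (X Y : Ω → ℝ), Measurable X ∧ Measurable Y ∧
      (∀ ω, X ω ∈ Set.Icc c d) ∧ (∀ ω, Y ω ∈ Set.Icc c d) ∧
      SD μ X Y n ∧ ¬ SDI μ X Y n c d := by
  obtain ⟨s, hs, rfl⟩ : ∃ s : ℝ, 0 < s ∧ c = d - 4 * s :=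
    ⟨(d - c) / 4, by linarith, by ring⟩
  let X : Fin 16 → ℝ := fun i => if (i : ℕ) < 8 then d - 2 * s else d
  let Y : Fin 16 → ℝ := fun i => if (i : ℕ) < 1 then d - 4 * s else d - s
  have hX (f : ℝ → ℝ) : ∫ i, f (X i) ∂(PMF.uniformOfFintype (Fin 16)).toMeasure =
      (8 * f (d - 2 * s) + 8 * f d) / 16 := by
    rw [integral_uniform_fin]
    simp [X, Fin.sum_univ_succ]
    ring
  have hY (f : ℝ → ℝ) : ∫ i, f (Y i) ∂(PMF.uniformOfFintype (Fin 16)).toMeasure =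
      (f (d - 4 * s) + 15 * f (d - s)) / 16 := by
    rw [integral_uniform_fin]
    simp [Y, Fin.sum_univ_succ]
    ring
  refine ⟨Fin 16, inferInstance, (PMF.uniformOfFintype (Fin 16)).toMeasure, inferInstance,
    X, Y, measurable_of_finite X, measurable_of_finite Y, fun i => ?_, fun i => ?_,
    fun η => ?_, fun h => ?_⟩
  · simp only [X]
    split_ifs <;> constructor <;> linarith
  · simp only [Y]
    split_ifs <;> constructor <;> linarith
  · have h := two_point_posPart_pow_le hs.le (m := n - 1) (by omega) (η - d)
    rw [hX, hY]
    simp only [momFn, if_neg (show n ≠ 1 by omega), sub_sub_eq_add_sub, sub_add_eq_add_sub] at h ⊢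
    gcongr
  · have h3 := h.2 3 (Finset.mem_Icc.2 ⟨by norm_num, by omega⟩)
    rw [hX fun x => (d - x) ^ (3 - 1), hY fun x => (d - x) ^ (3 - 1)] at h3
    norm_num at h3
    nlinarith [pow_pos hs 2]
end

section
/- Let X be a random variable with P(X = 2/9) = 809/900 and P(X = 1) = 91/900, and let Y be a random variable with P(Y = 0) = 1/3 and P(Y = 4/9) = 2/3. Then E[(η−X)₊³] ≤ E[(η−Y)₊³] for all η ∈ ℝ (so X ≥₄ Y), while E[(1−X)²] − E[(1−Y)²] = 341/72900 > 0, so X does not dominate Y in fourth-order stochastic dominance on [0,1]. -/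
open MeasureTheory Filter Set

/-- The expectation of `f ∘ Z` for a random variable `Z` concentrated on two points. -/
lemma integral_comp_of_two_point {Ω : Type*} [MeasurableSpace Ω] (μ : Measure Ω)
    [IsProbabilityMeasure μ] {Z : Ω → ℝ} (hZ : Measurable Z) {a b : ℝ} (hab : a ≠ b)
    {p q : ENNReal} (ha : μ {ω | Z ω = a} = p) (hb : μ {ω | Z ω = b} = q) (hpq : p + q = 1)
    (f : ℝ → ℝ) : ∫ ω, f (Z ω) ∂μ = p.toReal * f a + q.toReal * f b := by
  have hA : MeasurableSet {ω | Z ω = a} := hZ (measurableSet_singleton a)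
  have hB : MeasurableSet {ω | Z ω = b} := hZ (measurableSet_singleton b)
  have hdisj : Disjoint {ω | Z ω = a} {ω | Z ω = b} :=
    Set.disjoint_left.2 fun ω h₁ h₂ => hab (h₁.symm.trans h₂)
  have hae : ∀ᵐ ω ∂μ, ω ∈ {ω | Z ω = a} ∪ {ω | Z ω = b} := by
    refine (mem_ae_iff_prob_eq_one (hA.union hB)).2 ?_
    rw [measure_union hdisj hB, ha, hb, hpq]
  have hfun : (fun ω => f (Z ω)) =ᵐ[μ] fun ω =>
      {ω | Z ω = a}.indicator (fun _ => f a) ω + {ω | Z ω = b}.indicator (fun _ => f b) ω := by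
    filter_upwards [hae] with ω hω
    rcases hω with h | h
    · have h' : Z ω = a := h
      simp [h', hab]
    · have h' : Z ω = b := h
      simp [h', hab.symm]
  rw [integral_congr_ae hfun, integral_add ((integrable_const _).indicator hA)
    ((integrable_const _).indicator hB), integral_indicator_const _ hA,
    integral_indicator_const _ hB, measureReal_def, measureReal_def, ha, hb,
    smul_eq_mul, smul_eq_mul]

/-- The cubic lower partial moments of the two distributions are ordered. -/
lemma cubic_lower_partial_moment_le (η : ℝ) :
    809 / 900 * (max (η - 2 / 9) 0) ^ 3 + 91 / 900 * (max (η - 1) 0) ^ 3 ≤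
      1 / 3 * (max (η - 0) 0) ^ 3 + 2 / 3 * (max (η - 4 / 9) 0) ^ 3 := by
  rcases le_total η (2 / 9) with h₁ | h₁
  · rw [max_eq_right (by linarith : η - 2 / 9 ≤ 0), max_eq_right (by linarith : η - 1 ≤ 0)]
    simp only [ne_eq, OfNat.ofNat_ne_zero, not_false_eq_true, zero_pow, mul_zero, add_zero]
    positivity
  rw [max_eq_left (by linarith : 0 ≤ η - 2 / 9), max_eq_left (by linarith : 0 ≤ η - 0)]
  rcases le_total η (4 / 9) with h₂ | h₂
  · rw [max_eq_right (by linarith : η - 1 ≤ 0), max_eq_right (by linarith : η - 4 / 9 ≤ 0)]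
    have h : (2 * (η - 2 / 9)) ^ 3 ≤ η ^ 3 :=
      pow_le_pow_left₀ (by linarith) (by linarith) 3
    have h' : 0 ≤ (η - 2 / 9) ^ 3 := pow_nonneg (by linarith) 3
    nlinarith
  rw [max_eq_left (by linarith : 0 ≤ η - 4 / 9)]
  rcases le_total η 1 with h₃ | h₃
  · rw [max_eq_right (by linarith : η - 1 ≤ 0)]
    nlinarith [mul_nonneg (sub_nonneg.2 h₂) (sub_nonneg.2 h₃),
      mul_nonneg (sub_nonneg.2 h₂) (sq_nonneg (η - 5 / 6)),
      mul_nonneg (sub_nonneg.2 h₂) (sq_nonneg (η - 1)), sq_nonneg (η - 4 / 5)]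
  · rw [max_eq_left (by linarith : 0 ≤ η - 1)]
    nlinarith [sq_nonneg (η - 3 / 2)]

theorem stmt_6 {Ω : Type*} [MeasurableSpace Ω] (μ : Measure Ω) [IsProbabilityMeasure μ]
    (X Y : Ω → ℝ) (hX : Measurable X) (hY : Measurable Y)
    (hX1 : μ {ω | X ω = 2 / 9} = 809 / 900) (hX2 : μ {ω | X ω = 1} = 91 / 900)
    (hY1 : μ {ω | Y ω = 0} = 1 / 3) (hY2 : μ {ω | Y ω = 4 / 9} = 2 / 3) :
    (∀ η : ℝ, (∫ ω, (max (η - X ω) 0) ^ 3 ∂μ) ≤ ∫ ω, (max (η - Y ω) 0) ^ 3 ∂μ) ∧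
    SD μ X Y 4 ∧
    ((∫ ω, (1 - X ω) ^ 2 ∂μ) - ∫ ω, (1 - Y ω) ^ 2 ∂μ) = 341 / 72900 ∧
    ¬ SDI μ X Y 4 0 1 := by
  have hp : (809 / 900 : ENNReal) + 91 / 900 = 1 := by
    rw [ENNReal.div_add_div_same]; norm_num
    exact ENNReal.div_self (by norm_num) (by norm_num)
  have hq : (1 / 3 : ENNReal) + 2 / 3 = 1 := by
    rw [ENNReal.div_add_div_same]; norm_num
    exact ENNReal.div_self (by norm_num) (by norm_num)
  have hEX (f : ℝ → ℝ) : ∫ ω, f (X ω) ∂μ = 809 / 900 * f (2 / 9) + 91 / 900 * f 1 := by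
    simpa using integral_comp_of_two_point μ hX (by norm_num) hX1 hX2 hp f
  have hEY (f : ℝ → ℝ) : ∫ ω, f (Y ω) ∂μ = 1 / 3 * f 0 + 2 / 3 * f (4 / 9) := by
    simpa using integral_comp_of_two_point μ hY (by norm_num) hY1 hY2 hq f
  have hle (η : ℝ) :
      (∫ ω, (max (η - X ω) 0) ^ 3 ∂μ) ≤ ∫ ω, (max (η - Y ω) 0) ^ 3 ∂μ := by
    rw [hEX fun x => (max (η - x) 0) ^ 3, hEY fun x => (max (η - x) 0) ^ 3]
    exact cubic_lower_partial_moment_le η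
  have hgap : ((∫ ω, (1 - X ω) ^ 2 ∂μ) - ∫ ω, (1 - Y ω) ^ 2 ∂μ) = 341 / 72900 := by
    rw [hEX fun x => (1 - x) ^ 2, hEY fun x => (1 - x) ^ 2]
    norm_num
  refine ⟨hle, fun η => by simpa [momFn] using hle η, hgap, fun h => ?_⟩
  have h₃ := h.2 3 (by simp)
  norm_num at h₃
  linarith
end

section
/- Let Z be a bounded random variable and n ≥ 1 an integer. Then lim_{η→∞} ( η − ( E[(η−Z)₊ⁿ] )^{1/n} ) = E[Z]. -/
open MeasureTheory Filter Set

/-- The moment function `s ↦ E[(1 - s Z)ⁿ]` of a bounded random variable has derivative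
`-n E[Z]` at `0`. -/
theorem hasDerivAt_integral_one_sub_mul_pow {Ω : Type*} [MeasurableSpace Ω] (μ : Measure Ω)
    [IsProbabilityMeasure μ] {Z : Ω → ℝ} (hZ : Measurable Z) {C : ℝ} (hC : ∀ ω, |Z ω| ≤ C)
    (n : ℕ) :
    HasDerivAt (fun s : ℝ => ∫ ω, (1 - s * Z ω) ^ n ∂μ) (-(n * ∫ ω, Z ω ∂μ)) 0 := by
  have key := (hasDerivAt_integral_of_dominated_loc_of_deriv_le (μ := μ)
    (F := fun (s : ℝ) ω => (1 - s * Z ω) ^ n)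
    (F' := fun (s : ℝ) ω => n * (1 - s * Z ω) ^ (n - 1) * (-Z ω))
    (x₀ := 0) (s := Metric.ball 0 1) (bound := fun _ => n * (1 + C) ^ (n - 1) * C)
    (Metric.ball_mem_nhds _ one_pos)
    (Eventually.of_forall fun s => by fun_prop) (by simp) (by fun_prop)
    (Eventually.of_forall fun ω s hs => ?_) (integrable_const _)
    (Eventually.of_forall fun ω s _ => ?_)).2
  · simpa [integral_neg, integral_const_mul] using key
  · have hs : |s| ≤ 1 := by simpa using (mem_ball_zero_iff.mp hs).le
    have hZC := hC ω
    have hbase : |1 - s * Z ω| ≤ 1 + C := by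
      calc |1 - s * Z ω| ≤ |1| + |s * Z ω| := abs_sub _ _
        _ ≤ 1 + C := by
          rw [abs_one, abs_mul]
          nlinarith [abs_nonneg s, abs_nonneg (Z ω)]
    have hC0 : 0 ≤ C := (abs_nonneg _).trans hZC
    simp only [norm_mul, norm_pow, norm_neg, Real.norm_eq_abs, Nat.abs_cast]
    gcongr
  · simpa using (((hasDerivAt_id s).mul_const (Z ω)).const_sub 1).fun_pow n

theorem stmt_8 {Ω : Type*} [MeasurableSpace Ω] (μ : Measure Ω) [IsProbabilityMeasure μ]
    (Z : Ω → ℝ) (hZ : Measurable Z) (hZb : ∃ C, ∀ ω, |Z ω| ≤ C)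
    (n : ℕ) (hn : 1 ≤ n) :
    Tendsto (fun η : ℝ => η - (∫ ω, (max (η - Z ω) 0) ^ n ∂μ) ^ ((n : ℝ)⁻¹))
      atTop (nhds (∫ ω, Z ω ∂μ)) := by
  obtain ⟨C, hC⟩ := hZb
  have hn0 : (n : ℝ) ≠ 0 := by positivity
  have hroot : HasDerivAt (fun s : ℝ => (∫ ω, (1 - s * Z ω) ^ n ∂μ) ^ ((n : ℝ)⁻¹))
      (-∫ ω, Z ω ∂μ) 0 := by
    convert (hasDerivAt_integral_one_sub_mul_pow μ hZ hC n).rpow_const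
      (p := (n : ℝ)⁻¹) (by simp) using 1
    simp [field]
  have hslope := (hasDerivAt_iff_tendsto_slope.mp hroot).neg.comp
    (tendsto_inv_atTop_nhdsGT_zero.mono_right (nhdsGT_le_nhdsNE (0 : ℝ)))
  rw [neg_neg] at hslope
  refine hslope.congr' ?_
  filter_upwards [eventually_gt_atTop 0, eventually_ge_atTop C] with η hη hηC
  have hscale : ∫ ω, (max (η - Z ω) 0) ^ n ∂μ = η ^ n * ∫ ω, (1 - η⁻¹ * Z ω) ^ n ∂μ := by
    rw [← integral_const_mul]
    congr 1 with ω
    rw [max_eq_left (by linarith [le_abs_self (Z ω), hC ω]), ← mul_pow]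
    congr 1
    field_simp
  have hpos : 0 ≤ ∫ ω, (1 - η⁻¹ * Z ω) ^ n ∂μ := by
    refine integral_nonneg fun ω => pow_nonneg ?_ n
    rw [sub_nonneg, inv_mul_le_one₀ hη]
    linarith [le_abs_self (Z ω), hC ω]
  rw [hscale, Real.mul_rpow (by positivity) hpos, Real.pow_rpow_inv_natCast hη.le (by omega)]
  simp [slope_def_field]
  ring
end

section
/- Let n ≥ 1 be an integer and let X, Y be bounded random variables. If X dominates Y in nth-order stochastic dominance on ℝ (X ≥ₙ Y), then E[X] ≥ E[Y]. -/
open MeasureTheory Filter Set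

/-- Second-order upper bound complementing Bernoulli's inequality on `[-1, 1]`. -/
theorem exists_one_add_pow_le (m : ℕ) :
    ∃ K : ℝ, 0 ≤ K ∧ ∀ u : ℝ, |u| ≤ 1 → (1 + u) ^ m ≤ 1 + m * u + K * u ^ 2 := by
  induction m with
  | zero => exact ⟨0, le_rfl, fun u _ => by simp⟩
  | succ m ih =>
    obtain ⟨K, hK, h⟩ := ih
    refine ⟨m + 2 * K, by positivity, fun u hu => ?_⟩
    obtain ⟨hl, hr⟩ := abs_le.mp hu
    have h1 := mul_le_mul_of_nonneg_right (h u hu) (by linarith : 0 ≤ 1 + u)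
    have h2 : 0 ≤ K * u ^ 2 * (1 - u) := mul_nonneg (by positivity) (by linarith)
    rw [pow_succ]
    push_cast
    linarith

/-- First-order stochastic dominance implies the comparison of expectations. -/
theorem SD.integral_le_of_one {Ω : Type*} [MeasurableSpace Ω] {μ : Measure Ω}
    [IsProbabilityMeasure μ] {X Y : Ω → ℝ} (hX : Measurable X) (hY : Measurable Y) {C : ℝ}
    (hXC : ∀ ω, |X ω| ≤ C) (hYC : ∀ ω, |Y ω| ≤ C) (h : SD μ X Y 1) :
    ∫ ω, Y ω ∂μ ≤ ∫ ω, X ω ∂μ := by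
  have integrable_of_bound {Z : Ω → ℝ} (hZ : Measurable Z) (hZC : ∀ ω, |Z ω| ≤ C) :
      Integrable Z μ :=
    Integrable.of_bound hZ.aestronglyMeasurable C (.of_forall hZC)
  have integral_momFn {Z : Ω → ℝ} (hZ : Measurable Z) (η : ℝ) :
      ∫ ω, momFn 1 η (Z ω) ∂μ = μ.real {ω | Z ω ≤ η} := by
    rw [← integral_indicator_one (measurableSet_le hZ measurable_const)]
    simp [momFn, Set.indicator_apply]
  have measure_lt_le (η : ℝ) : μ {ω | η < Y ω} ≤ μ {ω | η < X ω} := by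
    have hη := h η
    rw [integral_momFn hX, integral_momFn hY] at hη
    have compl_real {Z : Ω → ℝ} (hZ : Measurable Z) :
        μ.real {ω | η < Z ω} = 1 - μ.real {ω | Z ω ≤ η} := by
      rw [← probReal_compl_eq_one_sub (measurableSet_le hZ measurable_const)]
      congr 1
      ext ω
      simp
    rw [← ENNReal.toReal_le_toReal (measure_ne_top _ _) (measure_ne_top _ _)]
    change μ.real _ ≤ μ.real _
    rw [compl_real hX, compl_real hY]
    linarith
  have nonneg {Z : Ω → ℝ} (hZC : ∀ ω, |Z ω| ≤ C) : 0 ≤ fun ω => Z ω + C := fun ω => by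
    have := (abs_le.mp (hZC ω)).1
    simp only [Pi.zero_apply]
    linarith
  have shifted : ∫ ω, (Y ω + C) ∂μ ≤ ∫ ω, (X ω + C) ∂μ := by
    have hXi : Integrable (fun ω => X ω + C) μ :=
      (integrable_of_bound hX hXC).add (integrable_const C)
    have hYi : Integrable (fun ω => Y ω + C) μ :=
      (integrable_of_bound hY hYC).add (integrable_const C)
    rw [← ENNReal.ofReal_le_ofReal_iff (integral_nonneg (nonneg hXC)),
      ofReal_integral_eq_lintegral_ofReal hXi (.of_forall (nonneg hXC)),
      ofReal_integral_eq_lintegral_ofReal hYi (.of_forall (nonneg hYC)),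
      lintegral_eq_lintegral_meas_lt μ (.of_forall (nonneg hXC)) hXi.aemeasurable,
      lintegral_eq_lintegral_meas_lt μ (.of_forall (nonneg hYC)) hYi.aemeasurable]
    refine lintegral_mono fun t => ?_
    simpa only [sub_lt_iff_lt_add] using measure_lt_le (t - C)
  rw [integral_add (integrable_of_bound hY hYC) (integrable_const C),
    integral_add (integrable_of_bound hX hXC) (integrable_const C)] at shifted
  linarith

/-- Stochastic dominance of order `m + 1` with `m ≥ 1` implies the comparison of expectations:
expand the `m`th moments of `1 - t X` and `1 - t Y` to first order as `t → 0`. -/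
theorem SD.integral_le_of_succ {Ω : Type*} [MeasurableSpace Ω] {μ : Measure Ω}
    [IsProbabilityMeasure μ] {m : ℕ} (hm : 1 ≤ m) {X Y : Ω → ℝ} (hX : Measurable X)
    (hY : Measurable Y) {C : ℝ} (hC : 0 < C) (hXC : ∀ ω, |X ω| ≤ C) (hYC : ∀ ω, |Y ω| ≤ C)
    (h : SD μ X Y (m + 1)) : ∫ ω, Y ω ∂μ ≤ ∫ ω, X ω ∂μ := by
  obtain ⟨K, hK, hpow⟩ := exists_one_add_pow_le m
  have hXi : Integrable X μ := Integrable.of_bound hX.aestronglyMeasurable C (.of_forall hXC)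
  have hYi : Integrable Y μ := Integrable.of_bound hY.aestronglyMeasurable C (.of_forall hYC)
  have abs_mul_le {t x : ℝ} (ht : 0 < t) (htC : t * C ≤ 1) (hx : |x| ≤ C) : |-(t * x)| ≤ 1 := by
    rw [abs_neg, abs_mul, abs_of_pos ht]
    exact (mul_le_mul_of_nonneg_left hx ht.le).trans htC
  have integrable_pow {Z : Ω → ℝ} (hZ : Measurable Z) (hZC : ∀ ω, |Z ω| ≤ C) {t : ℝ}
      (ht : 0 < t) (htC : t * C ≤ 1) : Integrable (fun ω => (1 + -(t * Z ω)) ^ m) μ := by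
    refine Integrable.of_bound (by fun_prop) (2 ^ m) (.of_forall fun ω => ?_)
    obtain ⟨hl, hr⟩ := abs_le.mp (abs_mul_le ht htC (hZC ω))
    rw [norm_pow, Real.norm_eq_abs, abs_of_nonneg (by linarith)]
    exact pow_le_pow_left₀ (by linarith) (by linarith) m
  have integral_momFn {Z : Ω → ℝ} (hZC : ∀ ω, |Z ω| ≤ C) {t : ℝ} (ht : 0 < t)
      (htC : t * C ≤ 1) :
      ∫ ω, momFn (m + 1) t⁻¹ (Z ω) ∂μ = t⁻¹ ^ m * ∫ ω, (1 + -(t * Z ω)) ^ m ∂μ := by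
    rw [← integral_const_mul]
    refine integral_congr_ae (.of_forall fun ω => ?_)
    have factor : t⁻¹ - Z ω = t⁻¹ * (1 + -(t * Z ω)) := by field_simp; ring
    have hnonneg : 0 ≤ t⁻¹ * (1 + -(t * Z ω)) :=
      mul_nonneg (by positivity) (by linarith [(abs_le.mp (abs_mul_le ht htC (hZC ω))).1])
    simp only [momFn, if_neg (show m + 1 ≠ 1 by omega), Nat.add_sub_cancel]
    rw [factor, max_eq_left hnonneg, mul_pow]
  have first_order {t : ℝ} (ht : 0 < t) (htC : t * C ≤ 1) :
      m * (∫ ω, Y ω ∂μ - ∫ ω, X ω ∂μ) ≤ K * C ^ 2 * t := by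
    have hmom := h t⁻¹
    rw [integral_momFn hXC ht htC, integral_momFn hYC ht htC] at hmom
    have hmom' := le_of_mul_le_mul_left hmom (by positivity)
    have lower : ∫ ω, (1 - m * t * X ω) ∂μ ≤ ∫ ω, (1 + -(t * X ω)) ^ m ∂μ := by
      refine integral_mono ((integrable_const _).sub (hXi.const_mul _))
        (integrable_pow hX hXC ht htC) fun ω => ?_
      have := one_add_mul_le_pow
        (by linarith [(abs_le.mp (abs_mul_le ht htC (hXC ω))).1] : -2 ≤ -(t * X ω)) m
      simp only
      linarith
    have upper : ∫ ω, (1 + -(t * Y ω)) ^ m ∂μ ≤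
        ∫ ω, (1 + K * C ^ 2 * t ^ 2 - m * t * Y ω) ∂μ := by
      refine integral_mono (integrable_pow hY hYC ht htC)
        ((integrable_const _).sub (hYi.const_mul _)) fun ω => ?_
      have hp := hpow _ (abs_mul_le ht htC (hYC ω))
      have hsq : K * t ^ 2 * Y ω ^ 2 ≤ K * t ^ 2 * C ^ 2 :=
        mul_le_mul_of_nonneg_left (sq_le_sq' (abs_le.mp (hYC ω)).1 (abs_le.mp (hYC ω)).2)
          (by positivity)
      simp only
      linarith
    rw [integral_sub (integrable_const _) (hXi.const_mul _), integral_const_mul] at lower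
    rw [integral_sub (integrable_const _) (hYi.const_mul _), integral_const_mul] at upper
    simp only [integral_const, probReal_univ, one_smul] at lower upper
    refine le_of_mul_le_mul_left ?_ ht
    linarith
  by_contra! hlt
  set d := ∫ ω, Y ω ∂μ - ∫ ω, X ω ∂μ with hd
  have hdpos : 0 < d := by linarith
  have hden : 0 < K * C ^ 2 + 1 := by positivity
  have ht : 0 < min C⁻¹ (d / (K * C ^ 2 + 1)) := lt_min (by positivity) (by positivity)
  have htC : min C⁻¹ (d / (K * C ^ 2 + 1)) * C ≤ 1 :=
    (mul_le_mul_of_nonneg_right (min_le_left _ _) hC.le).trans (inv_mul_cancel₀ hC.ne').le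
  have hmd : d ≤ m * d := le_mul_of_one_le_left hdpos.le (by exact_mod_cast hm)
  have htd := (le_div_iff₀ hden).mp (min_le_right C⁻¹ (d / (K * C ^ 2 + 1)))
  linarith [first_order ht htC]

theorem stmt_9 {Ω : Type*} [MeasurableSpace Ω] (μ : Measure Ω) [IsProbabilityMeasure μ]
    (n : ℕ) (hn : 1 ≤ n)
    (X Y : Ω → ℝ) (hX : Measurable X) (hY : Measurable Y)
    (hXb : ∃ C, ∀ ω, |X ω| ≤ C) (hYb : ∃ C, ∀ ω, |Y ω| ≤ C)
    (h : SD μ X Y n) : (∫ ω, Y ω ∂μ) ≤ ∫ ω, X ω ∂μ := by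
  obtain ⟨A, hA⟩ := hXb
  obtain ⟨B, hB⟩ := hYb
  have hXC (ω : Ω) : |X ω| ≤ max (max A B) 1 :=
    (hA ω).trans ((le_max_left _ _).trans (le_max_left _ _))
  have hYC (ω : Ω) : |Y ω| ≤ max (max A B) 1 :=
    (hB ω).trans ((le_max_right _ _).trans (le_max_left _ _))
  obtain ⟨m, rfl⟩ := Nat.exists_eq_add_of_le' hn
  rcases Nat.eq_zero_or_pos m with rfl | hm
  · exact SD.integral_le_of_one hX hY hXC hYC h
  · exact SD.integral_le_of_succ hm hX hY (lt_max_of_lt_right one_pos) hXC hYC h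
end

section
/- Let a < b be real numbers, n ≥ 2 an integer, and X, Y ∈ 𝒳_{[a,b]} with X ≥ₙ Y and E[X] > E[Y]. Then there exists M ≥ b such that E[(M−X)^{k−1}] ≤ E[(M−Y)^{k−1}] for every k ∈ {1,…,n−1}. -/
open MeasureTheory Filter Set

/-- Tangent line lower bound for `(t + x) ^ (m + 1)` at `t`. -/
lemma pow_add_tangent_le {t x : ℝ} (ht : 0 ≤ t) (hx : 0 ≤ x) (m : ℕ) :
    t ^ (m + 1) + (m + 1) * x * t ^ m ≤ (t + x) ^ (m + 1) := by
  induction m with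
  | zero => simp
  | succ m ih =>
    have h := mul_le_mul_of_nonneg_left ih (add_nonneg ht hx)
    have h' : 0 ≤ ((m : ℝ) + 1) * x ^ 2 * t ^ m := by positivity
    push_cast
    calc _ ≤ (t + x) * (t ^ (m + 1) + (m + 1) * x * t ^ m) := by ring_nf at h' ⊢; linarith
      _ ≤ (t + x) * (t + x) ^ (m + 1) := h
      _ = _ := by ring

/-- Upper bound for `(t + x) ^ (m + 1)`, affine in `x`, with slope the derivative at `t + c`. -/
lemma pow_add_le_secant {t x c : ℝ} (ht : 0 ≤ t) (hx : 0 ≤ x) (hxc : x ≤ c) (m : ℕ) :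
    (t + x) ^ (m + 1) ≤ t ^ (m + 1) + (m + 1) * x * (t + c) ^ m := by
  induction m with
  | zero => simp
  | succ m ih =>
    have hc : 0 ≤ c := hx.trans hxc
    have h₁ := mul_le_mul_of_nonneg_left ih ht
    have h₂ : x * (t + x) ^ (m + 1) ≤ x * (t + c) ^ (m + 1) := by gcongr
    have h₃ : 0 ≤ ((m : ℝ) + 1) * x * c * (t + c) ^ m := by positivity
    push_cast
    calc (t + x) ^ (m + 1 + 1) = t * (t + x) ^ (m + 1) + x * (t + x) ^ (m + 1) := by ring
      _ ≤ t * (t ^ (m + 1) + (m + 1) * x * (t + c) ^ m) + x * (t + c) ^ (m + 1) := add_le_add h₁ h₂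
      _ = t ^ (m + 1 + 1) + (m + 1 + 1) * x * (t + c) ^ (m + 1)
          - (m + 1) * x * c * (t + c) ^ m := by ring
      _ ≤ _ := by linarith

lemma eventually_mul_add_pow_le {u v : ℝ} (huv : u < v) (c : ℝ) (m : ℕ) :
    ∀ᶠ t : ℝ in atTop, u * (t + c) ^ m ≤ v * t ^ m := by
  have hlim : Tendsto (fun t : ℝ => u * (1 + c / t) ^ m) atTop (nhds u) := by
    simpa using
      ((((tendsto_const_nhds (x := c)).div_atTop tendsto_id).const_add 1).pow m).const_mul u
  filter_upwards [hlim.eventually (gt_mem_nhds huv), eventually_gt_atTop 0] with t h ht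
  have hsplit : u * (t + c) ^ m = u * (1 + c / t) ^ m * t ^ m := by
    rw [mul_assoc, ← mul_pow]
    congr 2
    field_simp
  rw [hsplit]
  gcongr

lemma integrable_comp_of_mem_Icc {Ω : Type*} [MeasurableSpace Ω] {μ : Measure Ω}
    [IsFiniteMeasure μ] {X : Ω → ℝ} {a b : ℝ} (hX : Measurable X)
    (hXab : ∀ ω, X ω ∈ Set.Icc a b) {f : ℝ → ℝ} (hf : Continuous f) :
    Integrable (fun ω => f (X ω)) μ := by
  obtain ⟨C, hC⟩ := isCompact_Icc.exists_bound_of_continuousOn (s := Set.Icc a b) hf.continuousOn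
  exact Integrable.of_bound (hf.measurable.comp hX).aestronglyMeasurable C
    (ae_of_all _ fun ω => hC _ (hXab ω))

/-- For bounded random variables, a strictly larger mean eventually gives smaller moments of
`M - X`. -/
lemma eventually_integral_sub_pow_le {Ω : Type*} [MeasurableSpace Ω] {μ : Measure Ω}
    [IsProbabilityMeasure μ] {X Y : Ω → ℝ} {a b : ℝ} (hX : Measurable X) (hY : Measurable Y)
    (hXab : ∀ ω, X ω ∈ Set.Icc a b) (hYab : ∀ ω, Y ω ∈ Set.Icc a b)
    (hmean : (∫ ω, Y ω ∂μ) < ∫ ω, X ω ∂μ) (j : ℕ) :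
    ∀ᶠ M : ℝ in atTop, (∫ ω, (M - X ω) ^ j ∂μ) ≤ ∫ ω, (M - Y ω) ^ j ∂μ := by
  rcases j with _ | m
  · simp
  have integral_affine : ∀ Z : Ω → ℝ, Measurable Z → (∀ ω, Z ω ∈ Set.Icc a b) → ∀ p q : ℝ,
      ∫ ω, (p + (m + 1) * (b - Z ω) * q) ∂μ = p + (m + 1) * ((b - ∫ ω, Z ω ∂μ) * q) := by
    intro Z hZ hZab p q
    have hi : Integrable Z μ := integrable_comp_of_mem_Icc hZ hZab continuous_id
    have hi' : Integrable (fun ω => b - Z ω) μ := (integrable_const b).sub hi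
    rw [integral_add (integrable_const p) ((hi'.const_mul _).mul_const _), integral_mul_const,
      integral_const_mul, integral_sub (integrable_const b) hi]
    simp [mul_assoc]
  have hev := eventually_mul_add_pow_le (sub_lt_sub_left hmean b) (b - a) m
  filter_upwards [(tendsto_atTop_add_const_right atTop (-b) tendsto_id).eventually hev,
    eventually_ge_atTop b] with M h hM
  have ht : 0 ≤ M + -b := by linarith
  calc ∫ ω, (M - X ω) ^ (m + 1) ∂μ
      ≤ ∫ ω, ((M + -b) ^ (m + 1) + (m + 1) * (b - X ω) * (M + -b + (b - a)) ^ m) ∂μ := by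
        refine integral_mono
          (integrable_comp_of_mem_Icc hX hXab (f := fun x => (M - x) ^ (m + 1)) (by fun_prop))
          (integrable_comp_of_mem_Icc hX hXab (f := fun x => (M + -b) ^ (m + 1)
            + (m + 1) * (b - x) * (M + -b + (b - a)) ^ m) (by fun_prop)) fun ω => ?_
        have hb := pow_add_le_secant ht (sub_nonneg.2 (hXab ω).2)
          (sub_le_sub_left (hXab ω).1 b) m
        rwa [show M + -b + (b - X ω) = M - X ω by ring] at hb
    _ ≤ ∫ ω, ((M + -b) ^ (m + 1) + (m + 1) * (b - Y ω) * (M + -b) ^ m) ∂μ := by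
        rw [integral_affine X hX hXab, integral_affine Y hY hYab]
        exact add_le_add_right (mul_le_mul_of_nonneg_left h (by positivity)) _
    _ ≤ ∫ ω, (M - Y ω) ^ (m + 1) ∂μ := by
        refine integral_mono
          (integrable_comp_of_mem_Icc hY hYab (f := fun x => (M + -b) ^ (m + 1)
            + (m + 1) * (b - x) * (M + -b) ^ m) (by fun_prop))
          (integrable_comp_of_mem_Icc hY hYab (f := fun x => (M - x) ^ (m + 1)) (by fun_prop))
          fun ω => ?_
        have hb := pow_add_tangent_le ht (sub_nonneg.2 (hYab ω).2) m
        rwa [show M + -b + (b - Y ω) = M - Y ω by ring] at hb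

theorem stmt_10 {Ω : Type*} [MeasurableSpace Ω] (μ : Measure Ω) [IsProbabilityMeasure μ]
    (a b : ℝ) (hab : a < b) (n : ℕ) (hn : 2 ≤ n)
    (X Y : Ω → ℝ) (hX : Measurable X) (hY : Measurable Y)
    (hXab : ∀ ω, X ω ∈ Set.Icc a b) (hYab : ∀ ω, Y ω ∈ Set.Icc a b)
    (hSD : SD μ X Y n) (hmean : (∫ ω, Y ω ∂μ) < ∫ ω, X ω ∂μ) :
    ∃ M ≥ b, ∀ k ∈ Finset.Icc 1 (n - 1),
      (∫ ω, (M - X ω) ^ (k - 1) ∂μ) ≤ ∫ ω, (M - Y ω) ^ (k - 1) ∂μ := by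
  have hev : ∀ᶠ M : ℝ in atTop, ∀ k ∈ Finset.Icc 1 (n - 1),
      (∫ ω, (M - X ω) ^ (k - 1) ∂μ) ≤ ∫ ω, (M - Y ω) ^ (k - 1) ∂μ :=
    (Finset.eventually_all _).2 fun k _ =>
      eventually_integral_sub_pow_le hX hY hXab hYab hmean (k - 1)
  exact ((eventually_ge_atTop b).and hev).exists
end

section
/- Let a < b be real numbers. There exists a sequence of pairs (Xₖ, Yₖ)ₖ∈ℕ of random variables taking values in [a,b] such that for every k: Xₖ ≥₄ Yₖ and E[Xₖ] − E[Yₖ] > 0, and moreover (E[Xₖ²] − E[Yₖ²]) / (E[Xₖ] − E[Yₖ]) → ∞ as k → ∞. -/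
open MeasureTheory Filter Set

/-- Cubic lower partial moments of the points `-2 - h`, `-2 + h + h³`, `-2`, `0` are dominated by
those of `-3`, `-1`, `-1`, `-1`. -/
lemma sum_posPart_cube_le {h : ℝ} (h0 : 0 < h) (h1 : h ≤ 1 / 10) (η : ℝ) :
    max (η - (-2 - h)) 0 ^ 3 + max (η - (-2 + h + h ^ 3)) 0 ^ 3 + max (η - -2) 0 ^ 3
      + max (η - 0) 0 ^ 3
    ≤ max (η - -3) 0 ^ 3 + max (η - -1) 0 ^ 3 + max (η - -1) 0 ^ 3 + max (η - -1) 0 ^ 3 := by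
  obtain ⟨y, rfl⟩ : ∃ y, η = y - 2 := ⟨η + 2, by ring⟩
  have hh : h ^ 2 ≤ 1 / 100 := by nlinarith
  have d0 : 0 < h ^ 3 := by positivity
  have d1 : h ^ 3 ≤ 1 / 1000 := by nlinarith
  have right_nonneg : 0 ≤ max (y - 2 - -1) 0 ^ 3 := by positivity
  rcases le_total y 0 with hy | hy
  · rw [max_eq_right (by linarith : y - 2 - (-2 + h + h ^ 3) ≤ 0),
      max_eq_right (by linarith : y - 2 - -2 ≤ 0), max_eq_right (by linarith : y - 2 - 0 ≤ 0)]
    have : max (y - 2 - (-2 - h)) 0 ^ 3 ≤ max (y - 2 - -3) 0 ^ 3 := by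
      gcongr
      linarith
    linarith
  rw [max_eq_left (by linarith : 0 ≤ y - 2 - (-2 - h)),
    max_eq_left (by linarith : 0 ≤ y - 2 - -2), max_eq_left (by linarith : 0 ≤ y - 2 - -3)]
  rcases le_total y (1 / 5) with hy5 | hy5
  · rw [max_eq_right (by linarith : y - 2 - 0 ≤ 0)]
    have e1 : (y - 2 - (-2 - h)) ^ 3 ≤ (3 / 10) ^ 3 := by
      gcongr <;> linarith
    have e2 : max (y - 2 - (-2 + h + h ^ 3)) 0 ^ 3 ≤ (1 / 5) ^ 3 := by
      gcongr
      exact max_le (by linarith) (by norm_num)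
    have e3 : (y - 2 - -2) ^ 3 ≤ (1 / 5) ^ 3 := by
      gcongr <;> linarith
    have e4 : 1 ^ 3 ≤ (y - 2 - -3) ^ 3 := by
      gcongr
      linarith
    norm_num at e1 e2 e3 e4 ⊢
    linarith [pow_nonneg (le_max_right (y - 2 + 1) 0) 3]
  rw [max_eq_left (by linarith : 0 ≤ y - 2 - (-2 + h + h ^ 3))]
  rcases le_total y 2 with hy2 | hy2
  · rw [max_eq_right (by linarith : y - 2 - 0 ≤ 0)]
    have e1 : (y - 2 - (-2 + h + h ^ 3)) ^ 3 ≤ (y - h) ^ 3 :=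
      pow_le_pow_left₀ (by linarith) (by linarith) 3
    have e2 : y * h ^ 2 ≤ 1 / 50 := by nlinarith
    rcases le_total y 1 with hy1 | hy1
    · nlinarith [mul_nonneg (sq_nonneg y) (by linarith : 0 ≤ 1 - y)]
    · rw [max_eq_left (by linarith : 0 ≤ y - 2 - -1)]
      have e3 : (2 - y) ^ 3 ≤ 1 ^ 3 := by
        gcongr
        linarith
      nlinarith
  · rw [max_eq_left (by linarith : 0 ≤ y - 2 - 0), max_eq_left (by linarith : 0 ≤ y - 2 - -1)]
    have h4 : h ^ 4 ≤ 1 := by nlinarith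
    have e1 : (1 + h ^ 4 / 2) ^ 2 ≤ (3 / 2) ^ 2 := by
      gcongr
      linarith
    have e2 : h * (1 + h ^ 4 / 2) ^ 2 ≤ 1 / 10 * (3 / 2) ^ 2 := by
      gcongr
    have e3 : 0 ≤ 3 * h * (h * (y - h) - 1 - h ^ 4 / 2) ^ 2 := by positivity
    have e4 : 0 ≤ (h ^ 3) ^ 3 := by positivity
    nlinarith

lemma momFn_four_affine {s : ℝ} (hs : 0 < s) (b η u : ℝ) :
    momFn 4 η (b + s * u) = s ^ 3 * max ((η - b) / s - u) 0 ^ 3 := by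
  have key : max (η - (b + s * u)) 0 = s * max ((η - b) / s - u) 0 := by
    rw [mul_max_of_nonneg _ _ hs.le, mul_zero]
    congr 1
    field_simp
    ring
  simp [momFn, key, mul_pow]

lemma integral_uniform_fin_four (f : Fin 4 → ℝ) :
    ∫ ω, f ω ∂(PMF.uniformOfFintype (Fin 4)).toMeasure = (f 0 + f 1 + f 2 + f 3) / 4 := by
  simp [PMF.integral_eq_sum, Fin.sum_univ_four]
  ring

theorem stmt_11 (a b : ℝ) (hab : a < b) :
    ∃ (Ω : Type) (_ : MeasurableSpace Ω) (μ : Measure Ω) (_ : IsProbabilityMeasure μ)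
      (X Y : ℕ → Ω → ℝ),
      (∀ k, Measurable (X k)) ∧ (∀ k, Measurable (Y k)) ∧
      (∀ k ω, X k ω ∈ Set.Icc a b) ∧ (∀ k ω, Y k ω ∈ Set.Icc a b) ∧
      (∀ k, SD μ (X k) (Y k) 4) ∧
      (∀ k, 0 < (∫ ω, X k ω ∂μ) - ∫ ω, Y k ω ∂μ) ∧
      Tendsto (fun k =>
          ((∫ ω, (X k ω) ^ 2 ∂μ) - ∫ ω, (Y k ω) ^ 2 ∂μ) /
            ((∫ ω, X k ω ∂μ) - ∫ ω, Y k ω ∂μ))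
        atTop atTop := by
  obtain ⟨s, hs, rfl⟩ : ∃ s, 0 < s ∧ a = b + s * (-3) := ⟨(b - a) / 3, by linarith, by ring⟩
  let h : ℕ → ℝ := fun k => 1 / ((k : ℝ) + 10)
  have h0 : ∀ k, 0 < h k := fun k => by positivity
  have h1 : ∀ k, h k ≤ 1 / 10 := fun k => by
    apply one_div_le_one_div_of_le <;> simp
  have h3 : ∀ k, h k ^ 3 ≤ 1 / 10 := fun k =>
    (pow_le_of_le_one (h0 k).le ((h1 k).trans (by norm_num)) (by norm_num)).trans (h1 k)
  have affine_mem : ∀ u : ℝ, -3 ≤ u → u ≤ 0 → b + s * u ∈ Set.Icc (b + s * (-3)) b :=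
    fun u hu hu' => ⟨by gcongr, by nlinarith⟩
  refine ⟨Fin 4, inferInstance, (PMF.uniformOfFintype (Fin 4)).toMeasure, inferInstance,
    fun k ω => b + s * ![-2 - h k, -2 + h k + h k ^ 3, -2, 0] ω,
    fun _ ω => b + s * ![-3, -1, -1, -1] ω, fun k => measurable_of_finite _,
    fun k => measurable_of_finite _, fun k ω => ?_, fun k ω => ?_, fun k η => ?_, fun k => ?_, ?_⟩
  · have := h0 k
    have := h1 k
    have := h3 k
    have : 0 < h k ^ 3 := by positivity
    apply affine_mem <;> fin_cases ω <;> simp <;> linarith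
  · apply affine_mem <;> fin_cases ω <;> simp
  · simp only [momFn_four_affine hs, integral_uniform_fin_four]
    have := mul_le_mul_of_nonneg_left
      (sum_posPart_cube_le (h0 k) (h1 k) ((η - b) / s)) (pow_pos hs 3).le
    simp only [Matrix.cons_val]
    linarith
  · simp only [integral_uniform_fin_four, Matrix.cons_val]
    have : 0 < s * h k ^ 3 := mul_pos hs (pow_pos (h0 k) 3)
    linarith
  · simp only [integral_uniform_fin_four, Matrix.cons_val]
    have lower : Tendsto (fun k : ℕ => s * (2 * k) + 2 * b) atTop atTop :=
      tendsto_atTop_add_const_right _ _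
        ((tendsto_natCast_atTop_atTop.const_mul_atTop two_pos).const_mul_atTop hs)
    refine tendsto_atTop_mono (fun k => ?_) lower
    have hk : (k : ℝ) = 1 / h k - 10 := by simp [h]
    have hpos := h0 k
    rw [hk]
    generalize h k = t at hpos
    have ratio : ((((b + s * (-2 - t)) ^ 2 + (b + s * (-2 + t + t ^ 3)) ^ 2 + (b + s * -2) ^ 2
          + (b + s * 0) ^ 2) / 4
        - ((b + s * -3) ^ 2 + (b + s * -1) ^ 2 + (b + s * -1) ^ 2 + (b + s * -1) ^ 2) / 4)
        / ((b + s * (-2 - t) + (b + s * (-2 + t + t ^ 3)) + (b + s * -2) + (b + s * 0)) / 4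
          - (b + s * -3 + (b + s * -1) + (b + s * -1) + (b + s * -1)) / 4))
        = s * (2 / t - 4 + 2 * t + t ^ 3) + 2 * b := by
      have den : ((b + s * (-2 - t) + (b + s * (-2 + t + t ^ 3)) + (b + s * -2) + (b + s * 0)) / 4
          - (b + s * -3 + (b + s * -1) + (b + s * -1) + (b + s * -1)) / 4) = s * t ^ 3 / 4 := by
        ring
      rw [den]
      field_simp
      ring
    rw [ratio]
    gcongr
    have : 0 < t ^ 3 := by positivity
    have : 2 * (1 / t) = 2 / t := by ring
    linarith
end

section
/- Let a, b, c, d be real numbers with a < b ≤ c < d and let n ≥ 4 be an integer. There exist random variables X, Y taking values in [a,b] such that X dominates Y in nth-order stochastic dominance on [a,d] (X ≥ₙ^{[a,d]} Y) but X does not dominate Y in nth-order stochastic dominance on [a,c] (X ≥ₙ^{[a,c]} Y fails). -/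
open MeasureTheory Filter Set

/-- The truncated power `t₊ᵐ`. -/
noncomputable def posPow (m : ℕ) (t : ℝ) : ℝ := (max t 0) ^ m

lemma posPow_of_nonneg {m : ℕ} {t : ℝ} (ht : 0 ≤ t) : posPow m t = t ^ m := by
  rw [posPow, max_eq_left ht]

lemma posPow_of_nonpos {m : ℕ} (hm : m ≠ 0) {t : ℝ} (ht : t ≤ 0) : posPow m t = 0 := by
  rw [posPow, max_eq_right ht, zero_pow hm]

lemma posPow_nonneg (m : ℕ) (t : ℝ) : 0 ≤ posPow m t :=
  pow_nonneg (le_max_right t 0) m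

lemma posPow_le_pow {m : ℕ} {t M : ℝ} (hM : 0 ≤ M) (ht : t ≤ M) : posPow m t ≤ M ^ m :=
  pow_le_pow_left₀ (le_max_right t 0) (max_le ht hM) m

lemma hasDerivAt_posPow_succ {m : ℕ} (hm : m ≠ 0) (t : ℝ) :
    HasDerivAt (posPow (m + 1)) ((m + 1 : ℝ) * posPow m t) t := by
  have hpow : HasDerivAt (fun x : ℝ => x ^ (m + 1)) ((m + 1 : ℝ) * t ^ m) t := by
    simpa using hasDerivAt_pow (m + 1) t
  rcases lt_trichotomy t 0 with ht | rfl | ht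
  · rw [posPow_of_nonpos hm ht.le, mul_zero]
    refine (hasDerivAt_const t (0 : ℝ)).congr_of_eventuallyEq ?_
    filter_upwards [Iio_mem_nhds ht] with x hx
    exact posPow_of_nonpos m.succ_ne_zero (le_of_lt hx)
  · rw [posPow_of_nonpos hm le_rfl, mul_zero]
    rw [zero_pow hm, mul_zero] at hpow
    rw [← hasDerivWithinAt_univ, ← Set.Iic_union_Ici (a := (0 : ℝ))]
    refine HasDerivWithinAt.union ?_ ?_
    · exact (hasDerivWithinAt_const (0 : ℝ) _ (0 : ℝ)).congr
        (fun x hx => posPow_of_nonpos m.succ_ne_zero hx)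
        (posPow_of_nonpos m.succ_ne_zero le_rfl)
    · exact hpow.hasDerivWithinAt.congr (fun x hx => posPow_of_nonneg hx)
        (posPow_of_nonneg le_rfl)
  · rw [posPow_of_nonneg ht.le]
    refine hpow.congr_of_eventuallyEq ?_
    filter_upwards [Ioi_mem_nhds ht] with x hx
    exact posPow_of_nonneg (le_of_lt hx)

/-- The third backward difference, with step `h`, of the truncated power `t₊ᵐ`. -/
noncomputable def thirdDiff (h : ℝ) (m : ℕ) (t : ℝ) : ℝ :=
  posPow m t - 3 * posPow m (t - h) + 3 * posPow m (t - 2 * h) - posPow m (t - 3 * h)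

lemma thirdDiff_of_le {h : ℝ} (hh : 0 < h) {m : ℕ} (hm : m ≠ 0) {t : ℝ} (ht : t ≤ h) :
    thirdDiff h m t = posPow m t := by
  rw [thirdDiff, posPow_of_nonpos hm (by linarith : t - h ≤ 0),
    posPow_of_nonpos hm (by linarith : t - 2 * h ≤ 0),
    posPow_of_nonpos hm (by linarith : t - 3 * h ≤ 0)]
  ring

lemma hasDerivAt_thirdDiff_succ (h : ℝ) {m : ℕ} (hm : m ≠ 0) (t : ℝ) :
    HasDerivAt (thirdDiff h (m + 1)) ((m + 1 : ℝ) * thirdDiff h m t) t := by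
  have key (c : ℝ) :
      HasDerivAt (fun x => posPow (m + 1) (x - c)) ((m + 1 : ℝ) * posPow m (t - c)) t :=
    (hasDerivAt_posPow_succ hm (t - c)).comp_sub_const t c
  have := (((hasDerivAt_posPow_succ hm t).sub ((key h).const_mul 3)).add
    ((key (2 * h)).const_mul 3)).sub (key (3 * h))
  refine this.congr_deriv ?_
  rw [thirdDiff]
  ring

lemma thirdDiff_two_nonneg {h : ℝ} (hh : 0 < h) (t : ℝ) : 0 ≤ thirdDiff h 2 t := by
  rcases le_total t h with h1 | h1
  · rw [thirdDiff_of_le hh two_ne_zero h1]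
    exact posPow_nonneg _ _
  rw [thirdDiff, posPow_of_nonneg (by linarith : 0 ≤ t),
    posPow_of_nonneg (by linarith : 0 ≤ t - h)]
  rcases le_total t (2 * h) with h2 | h2
  · rw [posPow_of_nonpos two_ne_zero (by linarith : t - 2 * h ≤ 0),
      posPow_of_nonpos two_ne_zero (by linarith : t - 3 * h ≤ 0)]
    nlinarith [mul_nonneg (sub_nonneg.2 h1) (sub_nonneg.2 h2), sq_nonneg h]
  rw [posPow_of_nonneg (by linarith : 0 ≤ t - 2 * h)]
  rcases le_total t (3 * h) with h3 | h3
  · rw [posPow_of_nonpos two_ne_zero (by linarith : t - 3 * h ≤ 0)]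
    nlinarith [sq_nonneg (t - 3 * h)]
  · rw [posPow_of_nonneg (by linarith : 0 ≤ t - 3 * h)]
    nlinarith

lemma monotone_thirdDiff_succ {h : ℝ} {m : ℕ} (hm : m ≠ 0)
    (hnonneg : ∀ t, 0 ≤ thirdDiff h m t) : Monotone (thirdDiff h (m + 1)) :=
  monotone_of_hasDerivAt_nonneg (fun t => hasDerivAt_thirdDiff_succ h hm t)
    (fun t => mul_nonneg (by positivity) (hnonneg t))

lemma thirdDiff_nonneg {h : ℝ} (hh : 0 < h) {m : ℕ} (hm : 2 ≤ m) (t : ℝ) :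
    0 ≤ thirdDiff h m t := by
  induction m, hm using Nat.le_induction generalizing t with
  | base => exact thirdDiff_two_nonneg hh t
  | succ m hm ih =>
    rcases le_total t h with ht | ht
    · rw [thirdDiff_of_le hh m.succ_ne_zero ht]
      exact posPow_nonneg _ _
    · refine le_trans ?_ (monotone_thirdDiff_succ (by omega) ih ht)
      rw [thirdDiff_of_le hh m.succ_ne_zero le_rfl]
      exact posPow_nonneg _ _

lemma pow_le_thirdDiff {h : ℝ} (hh : 0 < h) {m : ℕ} (hm : 3 ≤ m) {t : ℝ} (ht : h ≤ t) :
    h ^ m ≤ thirdDiff h m t := by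
  obtain ⟨m, rfl⟩ : ∃ l, m = l + 1 := ⟨m - 1, by omega⟩
  refine le_trans (le_of_eq ?_)
    (monotone_thirdDiff_succ (by omega) (thirdDiff_nonneg hh (by omega)) ht)
  rw [thirdDiff_of_le hh m.succ_ne_zero le_rfl, posPow_of_nonneg hh.le]

/-- A small perturbation of the third difference, supported on the three rightmost nodes,
keeps truncated power moments of order at least three nonnegative. -/
lemma perturbed_thirdDiff_nonneg {h s M ε : ℝ} (hh : 0 < h) (hs : h ≤ 2 * s) (hhM : h ≤ M)
    (hε : 0 ≤ ε) {m N : ℕ} (hm : 3 ≤ m) (hmN : m ≤ N) (hεs : ε * (4 * s) ≤ (h / M) ^ N)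
    {t : ℝ} (htM : t ≤ M) :
    0 ≤ thirdDiff h m t + ε * (4 * s * posPow m (t - 2 * h)
      - (2 * s - h) * posPow m (t - h) - (h + 2 * s) * posPow m (t - 3 * h)) := by
  have hm0 : m ≠ 0 := by omega
  have hM : 0 < M := hh.trans_le hhM
  rcases le_total t h with ht | ht
  · rw [thirdDiff_of_le hh hm0 ht, posPow_of_nonpos hm0 (by linarith : t - h ≤ 0),
      posPow_of_nonpos hm0 (by linarith : t - 2 * h ≤ 0),
      posPow_of_nonpos hm0 (by linarith : t - 3 * h ≤ 0)]
    simpa using posPow_nonneg m t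
  have hD := pow_le_thirdDiff hh hm ht
  have hsmall : ε * (4 * s) * M ^ m ≤ h ^ m := by
    calc ε * (4 * s) * M ^ m ≤ (h / M) ^ m * M ^ m := by
          gcongr
          exact hεs.trans (pow_le_pow_of_le_one (by positivity) ((div_le_one hM).2 hhM) hmN)
      _ = h ^ m := by rw [← mul_pow, div_mul_cancel₀ _ hM.ne']
  have b1 := mul_le_mul_of_nonneg_left
    (posPow_le_pow (m := m) hM.le (by linarith : t - h ≤ M)) (by linarith : 0 ≤ 2 * s - h)
  have b2 : 0 ≤ 4 * s * posPow m (t - 2 * h) :=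
    mul_nonneg (by linarith) (posPow_nonneg _ _)
  have b3 := mul_le_mul_of_nonneg_left
    (posPow_le_pow (m := m) hM.le (by linarith : t - 3 * h ≤ M)) (by linarith : 0 ≤ h + 2 * s)
  have hτ : -(4 * s * M ^ m) ≤ 4 * s * posPow m (t - 2 * h)
      - (2 * s - h) * posPow m (t - h) - (h + 2 * s) * posPow m (t - 3 * h) := by
    linarith
  have := mul_le_mul_of_nonneg_left hτ hε
  linarith

/-- Nonnegative weights on a finite type are realised, after normalisation, by a probability
measure. -/
lemma exists_isProbabilityMeasure_integral_eq_sum {ι : Type*} [Fintype ι] [MeasurableSpace ι]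
    [MeasurableSingletonClass ι] (w : ι → ℝ) (hw : ∀ i, 0 ≤ w i) (hpos : 0 < ∑ i, w i) :
    ∃ μ : Measure ι, IsProbabilityMeasure μ ∧
      ∀ f : ι → ℝ, ∫ i, f i ∂μ = (∑ i, w i * f i) / ∑ i, w i := by
  set T := ∑ i, w i with hT
  have hwT (i : ι) : 0 ≤ w i / T := div_nonneg (hw i) hpos.le
  refine ⟨∑ i, ENNReal.ofReal (w i / T) • Measure.dirac i, ⟨?_⟩, fun f => ?_⟩
  · simp only [Measure.finsetSum_apply, Measure.smul_apply, measure_univ, smul_eq_mul, mul_one]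
    rw [← ENNReal.ofReal_sum_of_nonneg fun i _ => hwT i, ← Finset.sum_div, ← hT,
      div_self hpos.ne', ENNReal.ofReal_one]
  · rw [integral_finsetSum_measure fun i _ =>
      (integrable_dirac (by simp)).smul_measure ENNReal.ofReal_ne_top]
    simp only [integral_smul_measure, integral_dirac, ENNReal.toReal_ofReal (hwT _), smul_eq_mul]
    rw [Finset.sum_div]
    exact Finset.sum_congr rfl fun i _ => by ring

theorem stmt_14 (a b c d : ℝ) (hab : a < b) (hbc : b ≤ c) (hcd : c < d)
    (n : ℕ) (hn : 4 ≤ n) :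
    ∃ (Ω : Type) (_ : MeasurableSpace Ω) (μ : Measure Ω) (_ : IsProbabilityMeasure μ)
      (X Y : Ω → ℝ), Measurable X ∧ Measurable Y ∧
      (∀ ω, X ω ∈ Set.Icc a b) ∧ (∀ ω, Y ω ∈ Set.Icc a b) ∧
      SDI μ X Y n a d ∧ ¬ SDI μ X Y n a c := by
  obtain ⟨h, rfl⟩ : ∃ h, b = a + 3 * h := ⟨(b - a) / 3, by ring⟩
  have hh : 0 < h := by linarith
  obtain ⟨s, rfl⟩ : ∃ s, d = a + 2 * h + s := ⟨d - a - 2 * h, by ring⟩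
  have hs : h < s := by linarith
  have hs0 : 0 < s := hh.trans hs
  obtain ⟨ε, hε, hεs⟩ : ∃ ε : ℝ, 0 < ε ∧ ε * (4 * s) ≤ (h / (2 * h + s)) ^ n :=
    ⟨(h / (2 * h + s)) ^ n / (4 * s), by positivity, by
      rw [div_mul_cancel₀ _ (by positivity)]⟩
  have hεsh : 0 < ε * (2 * s - h) := mul_pos hε (by linarith)
  have hεsh' : 0 < ε * (h + 2 * s) := mul_pos hε (by linarith)
  obtain ⟨μ, hμ, hint⟩ := exists_isProbabilityMeasure_integral_eq_sum
    ![1, 2 + ε * (2 * s - h), 1 + ε * (h + 2 * s)]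
    (by intro i; fin_cases i <;> simp <;> linarith)
    (by simp [Fin.sum_univ_three]; linarith)
  have hT : 0 < ∑ i, ![1, 2 + ε * (2 * s - h), 1 + ε * (h + 2 * s)] i := by
    simp [Fin.sum_univ_three]; linarith
  set X : Fin 3 → ℝ := ![a + h, a + h, a + 3 * h] with hX
  set Y : Fin 3 → ℝ := ![a, a + 2 * h, a + 2 * h] with hY
  have hcmp (g : ℝ → ℝ) : (∫ ω, g (X ω) ∂μ) ≤ ∫ ω, g (Y ω) ∂μ ↔
      0 ≤ (g a - 3 * g (a + h) + 3 * g (a + 2 * h) - g (a + 3 * h))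
        + ε * (4 * s * g (a + 2 * h) - (2 * s - h) * g (a + h)
          - (h + 2 * s) * g (a + 3 * h)) := by
    rw [hint, hint, div_le_div_iff_of_pos_right hT, ← sub_nonneg]
    simp only [Fin.sum_univ_three, hX, hY, Matrix.cons_val_zero, Matrix.cons_val_one,
      Matrix.cons_val]
    ring_nf
  have hpow (m : ℕ) (hm : 3 ≤ m) (hmn : m ≤ n) (η : ℝ) (hη : η ≤ a + 2 * h + s) :
      (∫ ω, posPow m (η - X ω) ∂μ) ≤ ∫ ω, posPow m (η - Y ω) ∂μ := by
    rw [hcmp fun x => posPow m (η - x)]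
    have := perturbed_thirdDiff_nonneg hh (by linarith) (by linarith) hε.le hm hmn hεs
      (by linarith : η - a ≤ 2 * h + s)
    simpa only [thirdDiff, sub_sub] using this
  have hXmem (ω : Fin 3) : X ω ∈ Set.Icc a (a + 3 * h) := by
    fin_cases ω <;> simp [hX] <;> (try constructor) <;> linarith
  have hYmem (ω : Fin 3) : Y ω ∈ Set.Icc a (a + 3 * h) := by
    fin_cases ω <;> simp [hY] <;> (try constructor) <;> linarith
  refine ⟨Fin 3, inferInstance, μ, hμ, X, Y, measurable_of_finite X, measurable_of_finite Y,
    hXmem, hYmem, ⟨?_, ?_⟩, ?_⟩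
  · intro η hη
    simp only [momFn, if_neg (by omega : n ≠ 1)]
    exact hpow (n - 1) (by omega) (by omega) η hη.2
  · intro k hk
    rw [Finset.mem_Icc] at hk
    obtain hk3 | hk3 := le_or_gt 3 (k - 1)
    · have := hpow (k - 1) hk3 (by omega) _ le_rfl
      have hX0 (ω : Fin 3) : 0 ≤ a + 2 * h + s - X ω := by linarith [(hXmem ω).2]
      have hY0 (ω : Fin 3) : 0 ≤ a + 2 * h + s - Y ω := by linarith [(hYmem ω).2]
      simpa only [posPow_of_nonneg (hX0 _), posPow_of_nonneg (hY0 _)] using this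
    · rw [hcmp fun x => (a + 2 * h + s - x) ^ (k - 1)]
      have hεh : 0 ≤ ε * (2 * h ^ 2) := by positivity
      interval_cases k - 1
      · exact le_of_eq (by ring)
      · exact hεh.trans (le_of_eq (by ring))
      · exact le_of_eq (by ring)
  · rintro ⟨-, hmom⟩
    have := hmom 3 (Finset.mem_Icc.2 ⟨by norm_num, by omega⟩)
    rw [hcmp fun x => (c - x) ^ (3 - 1)] at this
    have hneg : 0 < ε * (4 * h ^ 2 * (a + 2 * h + s - c)) :=
      mul_pos hε (mul_pos (by positivity) (by linarith))
    norm_num at this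
    linarith
end

section
/- Let a < b be real numbers and m, n integers with 0 ≤ m ≤ n−1. For all X, Y ∈ 𝒳_{[a,b]}, if X dominates Y in nth degree m-mean preserving stochastic dominance on [a,b] ((n,m)SD_{[a,b]}), then X dominates Y in nth degree m-mean preserving stochastic dominance on ℝ ((n,m)SD_ℝ). -/
open MeasureTheory Filter Set

/-- `(n,m)`-mean-preserving stochastic dominance on `[a,b]`. -/
def MPSDI {Ω : Type*} [MeasurableSpace Ω] (μ : Measure Ω) (X Y : Ω → ℝ)
    (n m : ℕ) (a b : ℝ) : Prop :=
  SDI μ X Y n a b ∧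
  ∀ k ∈ Finset.Icc 1 (m + 1), (∫ ω, (b - X ω) ^ (k - 1) ∂μ) = ∫ ω, (b - Y ω) ^ (k - 1) ∂μ

/-- `(n,m)`-mean-preserving stochastic dominance on ℝ. -/
def MPSDR {Ω : Type*} [MeasurableSpace Ω] (μ : Measure Ω) (X Y : Ω → ℝ)
    (n m : ℕ) : Prop :=
  SD μ X Y n ∧ ∀ k ∈ Finset.Icc 1 m, (∫ ω, (X ω) ^ k ∂μ) = ∫ ω, (Y ω) ^ k ∂μ

lemma integral_add_const_pow {Ω : Type*} [MeasurableSpace Ω] {μ : Measure Ω} {f : Ω → ℝ}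
    (hf : ∀ k : ℕ, Integrable (fun ω => f ω ^ k) μ) (c : ℝ) (N : ℕ) :
    ∫ ω, (f ω + c) ^ N ∂μ =
      ∑ k ∈ Finset.range (N + 1), (∫ ω, f ω ^ k ∂μ) * (c ^ (N - k) * (N.choose k : ℝ)) := by
  simp_rw [add_pow, mul_assoc]
  rw [integral_finsetSum _ fun k _ => (hf k).mul_const _]
  simp_rw [integral_mul_const]

lemma momFn_eq_zero_of_lt {n : ℕ} (hn : 1 ≤ n) {η x : ℝ} (h : η < x) : momFn n η x = 0 := by
  unfold momFn
  split_ifs with h1 h2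
  · linarith
  · rfl
  · rw [max_eq_right (by linarith), zero_pow (by omega)]

lemma momFn_eq_pow_of_le {n : ℕ} {η x : ℝ} (h : x ≤ η) : momFn n η x = (η - x) ^ (n - 1) := by
  unfold momFn
  split_ifs with h1
  · simp [h1]
  · rw [max_eq_left (by linarith)]

theorem stmt_15 {Ω : Type*} [MeasurableSpace Ω] (μ : Measure Ω) [IsProbabilityMeasure μ]
    (a b : ℝ) (hab : a < b) (m n : ℕ) (hmn : m + 1 ≤ n)
    (X Y : Ω → ℝ) (hX : Measurable X) (hY : Measurable Y)
    (hXab : ∀ ω, X ω ∈ Set.Icc a b) (hYab : ∀ ω, Y ω ∈ Set.Icc a b)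
    (h : MPSDI μ X Y n m a b) : MPSDR μ X Y n m := by
  obtain ⟨⟨hη, hle⟩, heq⟩ := h
  have iX := integrable_sub_pow_of_mem_Icc (μ := μ) hX hXab
  have iY := integrable_sub_pow_of_mem_Icc (μ := μ) hY hYab
  refine ⟨fun η => ?_, fun k hk => ?_⟩
  · rcases lt_or_ge η a with h1 | h1
    · have hn : 1 ≤ n := by omega
      simp [fun ω => momFn_eq_zero_of_lt hn (h1.trans_le (hXab ω).1),
        fun ω => momFn_eq_zero_of_lt hn (h1.trans_le (hYab ω).1)]
    rcases le_or_gt η b with h2 | h2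
    · exact hη η ⟨h1, h2⟩
    have expand (Z : Ω → ℝ) (hZ : ∀ ω, Z ω ∈ Set.Icc a b) :
        ∫ ω, momFn n η (Z ω) ∂μ = ∫ ω, ((b - Z ω) + (η - b)) ^ (n - 1) ∂μ := by
      refine integral_congr_ae (.of_forall fun ω => ?_)
      simp only [momFn_eq_pow_of_le ((hZ ω).2.trans h2.le)]
      ring
    rw [expand X hXab, expand Y hYab, integral_add_const_pow iX, integral_add_const_pow iY]
    refine Finset.sum_le_sum fun k hk => mul_le_mul_of_nonneg_right ?_ ?_
    · rw [Finset.mem_range] at hk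
      simpa using hle (k + 1) (Finset.mem_Icc.2 ⟨by omega, by omega⟩)
    · have : 0 ≤ η - b := by linarith
      positivity
  · have expand (Z : Ω → ℝ) :
        ∫ ω, Z ω ^ k ∂μ = (-1) ^ k * ∫ ω, ((b - Z ω) + -b) ^ k ∂μ := by
      rw [← integral_const_mul]
      refine integral_congr_ae (.of_forall fun ω => ?_)
      simp only [← mul_pow]
      ring
    rw [expand X, expand Y, integral_add_const_pow iX, integral_add_const_pow iY]
    congr 1
    refine Finset.sum_congr rfl fun j hj => ?_
    rw [Finset.mem_range] at hj
    rw [Finset.mem_Icc] at hk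
    congr 1
    simpa using heq (j + 1) (Finset.mem_Icc.2 ⟨by omega, by omega⟩)
end
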